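/- Let (I,J) be a partial permutation of size k with cycle-path type (μ,ν) and with |I ∪ J| = m. Then there exists a polynomial f_{(μ,ν)} ∈ ℤ[n, m_1, …, m_k], depending only on (μ,ν), of degree at most k under the grading deg n = 1 and deg m_i = i, such that for every positive integer n with (I,J) a partial permutation in S_n and every partition λ of n, (n)_m · E_λ[1_{IJ}] = f_{(μ,ν)}(n, m_1(λ), m_2(λ), …, m_k(λ)). -/

import Mathlib

open Finset Filter
open scoped Classical BigOperators

namespace PaperStmt

/-- One step of the partial injection encoded by the tuples `I`, `J`. -/
noncomputable def pstep {k : ℕ} (I J : Fin k → ℕ) (x : ℕ) : Option ℕ :=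
  if h : ∃ ℓ, I ℓ = x then some (J h.choose) else none

/-- Iterates of the partial injection encoded by `I`, `J`. -/
noncomputable def piter {k : ℕ} (I J : Fin k → ℕ) : ℕ → ℕ → Option ℕ
  | 0, x => some x
  | t + 1, x => (piter I J t x).bind (pstep I J)

/-- The vertex set of the graph `G(I,J)`. -/
def pverts {k : ℕ} (I J : Fin k → ℕ) : Finset ℕ :=
  Finset.image I Finset.univ ∪ Finset.image J Finset.univ

/-- The number of directed cycles of length `i` in the graph `G(I,J)`. -/
noncomputable def cycleMult {k : ℕ} (I J : Fin k → ℕ) (i : ℕ) : ℕ :=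
  ((pverts I J).filter fun x =>
    piter I J i x = some x ∧ ∀ t, 0 < t → t < i → piter I J t x ≠ some x).card / i

/-- The number of directed path components with exactly `ℓ` edges in `G(I,J)`. -/
noncomputable def pathMult {k : ℕ} (I J : Fin k → ℕ) (ℓ : ℕ) : ℕ :=
  ((pverts I J).filter fun x =>
    (∀ a, J a ≠ x) ∧ (piter I J ℓ x).isSome ∧ piter I J (ℓ + 1) x = none).card

/-- The cycle partition `μ` of the partial permutation `(I,J)`. -/
noncomputable def cyclePart {k : ℕ} (I J : Fin k → ℕ) : Multiset ℕ :=
  ∑ i ∈ Finset.range (k + 1), Multiset.replicate (cycleMult I J i) i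

/-- The path partition `ν` of the partial permutation `(I,J)`. -/
noncomputable def pathPart {k : ℕ} (I J : Fin k → ℕ) : Multiset ℕ :=
  ∑ i ∈ Finset.range (k + 1), Multiset.replicate (pathMult I J i) i

/-- The full cycle type of a permutation (including fixed points as parts equal to 1). -/
noncomputable def fullCycleType {n : ℕ} (π : Equiv.Perm (Fin n)) : Multiset ℕ :=
  π.cycleType + Multiset.replicate (n - π.support.card) 1

/-- The conjugacy class `K_λ` of permutations of cycle type `λ`. -/
noncomputable def KClass {n : ℕ} (lam : Nat.Partition n) : Finset (Equiv.Perm (Fin n)) :=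
  Finset.univ.filter fun π => fullCycleType π = lam.parts

/-- Expectation of a statistic over the uniform distribution on `K_λ`. -/
noncomputable def expect {n : ℕ} (lam : Nat.Partition n) (f : Equiv.Perm (Fin n) → ℝ) : ℝ :=
  (∑ π ∈ KClass lam, f π) / (KClass lam).card

/-- The indicator `1_{IJ}` of the partial permutation `(I,J)` in `S_n`. -/
noncomputable def indic {n k : ℕ} (I J : Fin k → Fin n) (π : Equiv.Perm (Fin n)) : ℝ :=
  if ∀ ℓ, π (I ℓ) = J ℓ then 1 else 0

/-- The permutation `π` maps every entry of the list `l` but the last one to the next entry. -/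
def Follows {n : ℕ} (π : Equiv.Perm (Fin n)) (l : List (Fin n)) : Prop :=
  l.IsChain fun a b => π a = b

/-- The permutation `π` runs cyclically through each list in `cs` and linearly through each list
in `ps`. -/
def Extends {n : ℕ} (π : Equiv.Perm (Fin n)) (cs ps : List (List (Fin n))) : Prop :=
  (∀ c ∈ cs, Follows π (c ++ c)) ∧ ∀ p ∈ ps, Follows π p

/-- The number of permutations of cycle type `lam` with prescribed cycles and paths. -/
noncomputable def extCount {n : ℕ} (lam : Nat.Partition n) (cs ps : List (List (Fin n))) : ℕ :=
  ((KClass lam).filter fun π => Extends π cs ps).card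

section Follows

variable {n : ℕ} {π : Equiv.Perm (Fin n)}

lemma follows_append {a b : List (Fin n)} :
    Follows π (a ++ b) ↔
      Follows π a ∧ Follows π b ∧ ∀ x ∈ a.getLast?, ∀ y ∈ b.head?, π x = y :=
  List.isChain_append

lemma follows_append_of_ne_nil {a b : List (Fin n)} (ha : a ≠ []) (hb : b ≠ []) :
    Follows π (a ++ b) ↔ Follows π a ∧ Follows π b ∧ b.head? = some (π (a.getLast ha)) := by
  rw [follows_append]
  obtain ⟨y, t, rfl⟩ := List.exists_cons_of_ne_nil hb
  simp [List.getLast?_eq_getLast_of_ne_nil ha, eq_comm]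

lemma Follows.exists_pred {l : List (Fin n)} (h : Follows π l) {w : Fin n} (hw : w ∈ l) :
    l.head? = some w ∨ ∃ a ∈ l.dropLast, π a = w := by
  induction l with
  | nil => simp at hw
  | cons a t ih =>
    rcases t with _ | ⟨b, t⟩
    · simp at hw; simp [hw]
    · rw [Follows, List.isChain_cons_cons] at h
      rcases List.mem_cons.1 hw with rfl | hw
      · simp
      · right
        rcases ih h.2 hw with h' | ⟨c, hc, rfl⟩
        · simp at h'
          exact ⟨a, by simp, by rw [h.1, h']⟩
        · exact ⟨c, by simp [hc], rfl⟩

lemma Follows.exists_mem_of_cycle {c : List (Fin n)} (h : Follows π (c ++ c)) {w : Fin n}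
    (hw : w ∈ c) : ∃ a ∈ c, π a = w := by
  have hc : c ≠ [] := List.ne_nil_of_mem hw
  have h' := (follows_append_of_ne_nil hc hc).1 h
  rcases h'.1.exists_pred hw with h1 | ⟨a, ha, rfl⟩
  · exact ⟨c.getLast hc, List.getLast_mem hc, by
      rw [h1] at h'; exact (Option.some_injective _ h'.2.2).symm⟩
  · exact ⟨a, List.mem_of_mem_dropLast ha, rfl⟩

lemma extends_close_iff {cs ps : List (List (Fin n))} {q : List (Fin n)} (hq : q ≠ []) :
    Extends π (q :: cs) ps ↔ Extends π cs (q :: ps) ∧ q.head? = some (π (q.getLast hq)) := by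
  simp only [Extends, List.forall_mem_cons, follows_append_of_ne_nil hq hq]
  tauto

lemma extends_grow_iff {cs ps : List (List (Fin n))} {q : List (Fin n)} (hq : q ≠ []) (x : Fin n) :
    Extends π cs ((q ++ [x]) :: ps) ↔ Extends π cs (q :: ps) ∧ x = π (q.getLast hq) := by
  have : Follows π [x] := List.isChain_singleton x
  simp only [Extends, List.forall_mem_cons, follows_append_of_ne_nil hq (List.cons_ne_nil x []),
    List.head?_cons, Option.some_inj]
  tauto

lemma extends_join_iff {cs ps : List (List (Fin n))} {q : List (Fin n)} (hq : q ≠ [])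
    (hps : ∀ p ∈ ps, p ≠ []) {i : ℕ} (hi : i < ps.length) :
    Extends π cs ((q ++ ps.getD i []) :: ps.eraseIdx i) ↔
      Extends π cs (q :: ps) ∧ (ps.getD i []).head? = some (π (q.getLast hq)) := by
  have e : ps.getD i [] = ps[i] := by simp [hi]
  have hperm : ∀ P : List (Fin n) → Prop, (∀ p ∈ ps, P p) ↔ P ps[i] ∧ ∀ p ∈ ps.eraseIdx i, P p := by
    intro P
    rw [← List.forall_mem_cons]
    exact forall_congr' fun p => by rw [(List.getElem_cons_eraseIdx_perm hi).mem_iff]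
  simp only [e, Extends, List.forall_mem_cons,
    follows_append_of_ne_nil hq (hps _ (List.getElem_mem hi)), hperm (Follows π)]
  tauto

end Follows

section Recursion

variable {n : ℕ}

lemma head_eq_of_mem_path {π : Equiv.Perm (Fin n)} {l q : List (Fin n)} (hl : Follows π l)
    (hq : q ≠ []) (hu : q.getLast hq ∉ l.dropLast) (hw : π (q.getLast hq) ∈ l) :
    l.head? = some (π (q.getLast hq)) := by
  rcases hl.exists_pred hw with h | ⟨a, ha, h⟩
  · exact h
  · exact absurd ((π.injective h) ▸ ha) hu

lemma mem_of_head?_eq {l : List (Fin n)} {w : Fin n} (h : l.head? = some w) : w ∈ l :=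
  List.mem_of_mem_head? h

lemma sum_successor_eq_one {π : Equiv.Perm (Fin n)} {cs ps : List (List (Fin n))}
    {q : List (Fin n)} (hq : q ≠ [])
    (hnd : (cs.flatten ++ (q :: ps).flatten).Nodup) (hπ : Extends π cs (q :: ps)) :
    (if q.head? = some (π (q.getLast hq)) then 1 else 0) +
      (∑ i ∈ range ps.length, if (ps.getD i []).head? = some (π (q.getLast hq)) then 1 else 0) +
      (∑ x ∈ ((cs.flatten ++ (q :: ps).flatten).toFinset)ᶜ,
        if x = π (q.getLast hq) then 1 else 0) = 1 := by
  set u := q.getLast hq with hu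
  set w := π u with hwdef
  have huq : u ∈ q := List.getLast_mem hq
  rw [List.flatten_cons, List.nodup_append, List.nodup_append] at hnd
  obtain ⟨-, ⟨hqn, hpn, hqp⟩, hcq⟩ := hnd
  obtain ⟨-, hpw⟩ := List.nodup_flatten.1 hpn
  have huq' : u ∉ q.dropLast := by
    intro h
    have h2 := List.dropLast_append_getLast hq
    rw [← h2, List.nodup_append] at hqn
    exact hqn.2.2 _ h u (by simp [hu]) rfl
  have hgd : ∀ i (hi : i < ps.length), ps.getD i [] = ps[i] := fun i hi => by simp [hi]
  rw [Finset.sum_ite_eq']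
  have hm : w ∈ ((cs.flatten ++ (q :: ps).flatten).toFinset)ᶜ ↔
      w ∉ cs.flatten ++ (q :: ps).flatten := by
    rw [Finset.mem_compl, List.mem_toFinset]
  by_cases hwV : w ∈ (cs.flatten ++ (q :: ps).flatten)
  · rw [if_neg fun h => hm.1 h hwV, add_zero]
    rw [List.flatten_cons, List.mem_append, List.mem_append] at hwV
    rcases hwV with hw | hw | hw
    · exfalso
      obtain ⟨c, hc, hw⟩ := List.mem_flatten.1 hw
      obtain ⟨a, ha, h⟩ := (hπ.1 c hc).exists_mem_of_cycle hw
      exact hcq a (List.mem_flatten.2 ⟨c, hc, ha⟩) u (by simp [huq]) (π.injective h)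
    · rw [if_pos (head_eq_of_mem_path (hπ.2 q (by simp)) hq huq' hw), add_eq_left]
      refine Finset.sum_eq_zero fun i hi => ?_
      rw [if_neg]
      intro h
      have hi := Finset.mem_range.1 hi
      rw [hgd i hi] at h
      exact hqp w hw w (List.mem_flatten.2 ⟨_, List.getElem_mem hi, mem_of_head?_eq h⟩) rfl
    · rw [if_neg fun h => hqp w (mem_of_head?_eq h) w hw rfl, zero_add]
      obtain ⟨p, hp, hw⟩ := List.mem_flatten.1 hw
      obtain ⟨i, hi, rfl⟩ := List.getElem_of_mem hp
      rw [Finset.sum_eq_single_of_mem i (Finset.mem_range.2 hi), if_pos]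
      · rw [hgd i hi]
        refine head_eq_of_mem_path (hπ.2 _ (by simp [hp])) hq (fun h => ?_) hw
        exact hqp u huq u (List.mem_flatten.2 ⟨_, hp, List.mem_of_mem_dropLast h⟩) rfl
      · intro j hj hji
        have hj := Finset.mem_range.1 hj
        rw [if_neg]
        intro h
        rw [hgd j hj] at h
        have hd := List.pairwise_iff_getElem.1 hpw
        rcases lt_or_gt_of_ne hji with h1 | h1
        · exact hd j i hj hi h1 (mem_of_head?_eq h) hw
        · exact hd i j hi hj h1 hw (mem_of_head?_eq h)
  · have h1 : q.head? ≠ some w := fun h => hwV (by simp [mem_of_head?_eq h])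
    rw [if_neg h1, if_pos (hm.2 hwV), zero_add, add_eq_right]
    refine Finset.sum_eq_zero fun i hi => ?_
    have hi := Finset.mem_range.1 hi
    rw [if_neg]
    intro h
    rw [hgd i hi] at h
    refine hwV ?_
    rw [List.flatten_cons, List.mem_append, List.mem_append]
    exact Or.inr (Or.inr (List.mem_flatten.2 ⟨_, List.getElem_mem hi, mem_of_head?_eq h⟩))

lemma extCount_eq_sum (lam : Nat.Partition n) {cs ps : List (List (Fin n))}
    {q : List (Fin n)} (hq : q ≠ []) (hps : ∀ p ∈ ps, p ≠ [])
    (hnd : (cs.flatten ++ (q :: ps).flatten).Nodup) :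
    extCount lam cs (q :: ps) = extCount lam (q :: cs) ps +
      (∑ i ∈ range ps.length, extCount lam cs ((q ++ ps.getD i []) :: ps.eraseIdx i)) +
      ∑ x ∈ ((cs.flatten ++ (q :: ps).flatten).toFinset)ᶜ,
        extCount lam cs ((q ++ [x]) :: ps) := by
  simp only [extCount, Finset.card_filter]
  rw [Finset.sum_comm, Finset.sum_comm (s := (_)ᶜ), ← Finset.sum_add_distrib,
    ← Finset.sum_add_distrib]
  refine Finset.sum_congr rfl fun π _ => ?_
  rw [Finset.sum_congr rfl (g := fun i => if Extends π cs (q :: ps) ∧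
    (ps.getD i []).head? = some (π (q.getLast hq)) then 1 else 0) fun i hi => by
      simp only [extends_join_iff hq hps (Finset.mem_range.1 hi)]]
  simp only [extends_close_iff hq, extends_grow_iff hq]
  by_cases h : Extends π cs (q :: ps)
  · simp only [h, true_and, if_true]
    exact (sum_successor_eq_one hq hnd h).symm
  · simp [h]

lemma fullCycleType_conj (g π : Equiv.Perm (Fin n)) :
    fullCycleType (g * π * g⁻¹) = fullCycleType π := by
  simp only [fullCycleType, Equiv.Perm.cycleType_conj, Equiv.Perm.card_support_conj]

lemma follows_map (g π : Equiv.Perm (Fin n)) (l : List (Fin n)) :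
    Follows (g * π * g⁻¹) (l.map g) ↔ Follows π l := by
  simp [Follows, List.isChain_map]

lemma extends_map (g π : Equiv.Perm (Fin n)) (cs ps : List (List (Fin n))) :
    Extends (g * π * g⁻¹) (cs.map (List.map g)) (ps.map (List.map g)) ↔ Extends π cs ps := by
  simp only [Extends, List.forall_mem_map, ← List.map_append, follows_map]

lemma extCount_map (lam : Nat.Partition n) (g : Equiv.Perm (Fin n)) (cs ps : List (List (Fin n))) :
    extCount lam (cs.map (List.map g)) (ps.map (List.map g)) = extCount lam cs ps := by
  symm
  refine Finset.card_equiv (MulAut.conj g).toEquiv fun π => ?_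
  simp [KClass, fullCycleType_conj, extends_map]

lemma extCount_grow_eq (lam : Nat.Partition n) {cs ps : List (List (Fin n))}
    {q : List (Fin n)} {v w : Fin n} (hv : v ∉ cs.flatten ++ (q :: ps).flatten)
    (hw : w ∉ cs.flatten ++ (q :: ps).flatten) :
    extCount lam cs ((q ++ [w]) :: ps) = extCount lam cs ((q ++ [v]) :: ps) := by
  have hfix : ∀ l : List (Fin n), l ∈ cs ∨ l ∈ q :: ps → l.map (Equiv.swap v w) = l := by
    intro l hl
    have hmem : ∀ x ∈ l, x ∈ cs.flatten ++ (q :: ps).flatten := fun x hx => by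
      rw [List.mem_append]
      exact hl.imp (fun h => List.mem_flatten.2 ⟨l, h, hx⟩) fun h => List.mem_flatten.2 ⟨l, h, hx⟩
    conv_rhs => rw [← List.map_id l]
    refine List.map_congr_left fun x hx => ?_
    exact Equiv.swap_apply_of_ne_of_ne (fun h => hv (h ▸ hmem x hx)) fun h => hw (h ▸ hmem x hx)
  have hfixs : ∀ ls : List (List (Fin n)), (∀ l ∈ ls, l ∈ cs ∨ l ∈ q :: ps) →
      ls.map (List.map (Equiv.swap v w)) = ls := by
    intro ls hls
    conv_rhs => rw [← List.map_id ls]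
    exact List.map_congr_left fun l hl => hfix l (hls l hl)
  rw [← extCount_map lam (Equiv.swap v w) cs ((q ++ [v]) :: ps), hfixs cs fun l hl => Or.inl hl,
    List.map_cons, hfixs ps fun l hl => Or.inr (List.mem_cons_of_mem _ hl), List.map_append,
    hfix q (Or.inr List.mem_cons_self)]
  simp

/-- Splitting the permutations that extend a configuration by the image of the last vertex of its
first path. -/
lemma extCount_recursion (lam : Nat.Partition n) {cs ps : List (List (Fin n))}
    {q : List (Fin n)} (hq : q ≠ []) (hps : ∀ p ∈ ps, p ≠ [])
    (hnd : (cs.flatten ++ (q :: ps).flatten).Nodup) {v : Fin n}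
    (hv : v ∉ cs.flatten ++ (q :: ps).flatten) :
    extCount lam cs (q :: ps) = extCount lam (q :: cs) ps +
      (∑ i ∈ range ps.length, extCount lam cs ((q ++ ps.getD i []) :: ps.eraseIdx i)) +
      (n - (cs.flatten ++ (q :: ps).flatten).length) * extCount lam cs ((q ++ [v]) :: ps) := by
  rw [extCount_eq_sum lam hq hps hnd, Finset.sum_congr rfl fun w hw =>
    extCount_grow_eq lam hv (by simpa using hw), Finset.sum_const, Finset.card_compl,
    List.toFinset_card_of_nodup hnd, Fintype.card_fin, smul_eq_mul]

end Recursion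

section Centralizer

/-- The order of the centralizer of a permutation whose full cycle type is `κ`. -/
noncomputable def centralizerOrder (κ : Multiset ℕ) : ℕ :=
  κ.prod * ∏ i ∈ κ.toFinset, (κ.count i).factorial

lemma centralizerOrder_eq_of_subset {κ : Multiset ℕ} {s : Finset ℕ} (h : κ.toFinset ⊆ s) :
    centralizerOrder κ = κ.prod * ∏ i ∈ s, (κ.count i).factorial := by
  rw [centralizerOrder, Finset.prod_subset h]
  intro x _ hx
  rw [Multiset.count_eq_zero_of_notMem (by simpa using hx), Nat.factorial_zero]

lemma centralizerOrder_cons (a : ℕ) (κ : Multiset ℕ) :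
    centralizerOrder (a ::ₘ κ) = a * (κ.count a + 1) * centralizerOrder κ := by
  have h : (a ::ₘ κ).toFinset ⊆ insert a κ.toFinset := by simp
  rw [centralizerOrder_eq_of_subset h,
    centralizerOrder_eq_of_subset (Finset.subset_insert a κ.toFinset),
    ← Finset.mul_prod_erase _ _ (Finset.mem_insert_self a _),
    ← Finset.mul_prod_erase _ (fun i => (κ.count i).factorial) (Finset.mem_insert_self a _),
    Multiset.count_cons_self, Nat.factorial_succ, Multiset.prod_cons,
    Finset.prod_congr rfl fun i hi => by
      rw [Multiset.count_cons_of_ne (Finset.ne_of_mem_erase hi)]]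
  ring

lemma centralizerOrder_pos {κ : Multiset ℕ} (h : ∀ a ∈ κ, 0 < a) : 0 < centralizerOrder κ :=
  Nat.mul_pos (Multiset.prod_pos h) (Finset.prod_pos fun _ _ => Nat.factorial_pos _)

lemma centralizerOrder_add_replicate_one {κ : Multiset ℕ} (h : 1 ∉ κ) (r : ℕ) :
    centralizerOrder (κ + Multiset.replicate r 1) = centralizerOrder κ * r.factorial := by
  induction r with
  | zero => simp
  | succ r ih =>
    rw [Multiset.replicate_succ, Multiset.add_cons, centralizerOrder_cons, ih,
      Multiset.count_add, Multiset.count_eq_zero_of_notMem h, Multiset.count_replicate_self,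
      Nat.factorial_succ]
    ring

end Centralizer

section CycleType

variable {n : ℕ}

lemma card_support_le (π : Equiv.Perm (Fin n)) : π.support.card ≤ n := by
  simpa using π.support.card_le_univ

lemma fullCycleType_mul {σ τ : Equiv.Perm (Fin n)} (h : σ.Disjoint τ) :
    fullCycleType (σ * τ) + Multiset.replicate n 1 = fullCycleType σ + fullCycleType τ := by
  have h1 := h.card_support_mul
  have h2 := card_support_le (σ * τ)
  simp only [fullCycleType, h.cycleType_mul]
  rw [show σ.cycleType + Multiset.replicate (n - σ.support.card) 1 +
      (τ.cycleType + Multiset.replicate (n - τ.support.card) 1) =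
      σ.cycleType + τ.cycleType + (Multiset.replicate (n - σ.support.card) 1 +
        Multiset.replicate (n - τ.support.card) 1) by abel, add_assoc,
    ← Multiset.replicate_add, ← Multiset.replicate_add]
  congr 2
  omega

lemma fullCycleType_formPerm {c : List (Fin n)} (hc : c.Nodup) (h0 : c ≠ []) :
    fullCycleType c.formPerm = c.length ::ₘ Multiset.replicate (n - c.length) 1 := by
  rcases c with _ | ⟨a, _ | ⟨b, t⟩⟩
  · exact absurd rfl h0
  · have : 0 < n := a.pos
    simp only [fullCycleType, List.formPerm_singleton, Equiv.Perm.cycleType_one,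
      Equiv.Perm.support_one, Finset.card_empty, List.length_singleton, zero_add, Nat.sub_zero]
    rw [← Multiset.replicate_succ]
    congr 1
    omega
  · rw [fullCycleType, (List.isCycle_formPerm hc (by simp)).cycleType,
      List.support_formPerm_of_nodup _ hc (by simp), List.toFinset_card_of_nodup hc]
    rfl

/-- The permutations that fix `V` pointwise, run cyclically through each list in `cs`, and have the
parts of `κ` as cycle lengths outside of `V`. -/
noncomputable def fixingExtensions (V : Finset (Fin n)) (cs : List (List (Fin n)))
    (κ : Multiset ℕ) : Finset (Equiv.Perm (Fin n)) :=
  Finset.univ.filter fun π => (∀ x ∈ V, π x = x) ∧ (∀ c ∈ cs, Follows π (c ++ c)) ∧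
    fullCycleType π = κ + Multiset.replicate V.card 1

lemma eq_filter_two_le_add_replicate {κ : Multiset ℕ} (hκ : ∀ a ∈ κ, 0 < a) :
    κ = κ.filter (fun a => 2 ≤ a) + Multiset.replicate (κ.count 1) 1 := by
  conv_lhs => rw [← Multiset.filter_add_not (fun a => 2 ≤ a) κ]
  congr 1
  rw [← Multiset.filter_eq']
  refine Multiset.filter_congr fun a ha => ?_
  have := hκ a ha
  omega

lemma fullCycleType_eq_iff {V : Finset (Fin n)} {κ : Multiset ℕ} (hκ : ∀ a ∈ κ, 0 < a)
    (hsum : κ.sum + V.card = n) (π : Equiv.Perm (Fin n)) :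
    fullCycleType π = κ + Multiset.replicate V.card 1 ↔
      π.cycleType = κ.filter fun a => 2 ≤ a := by
  have hdec : κ = κ.filter (fun a => 2 ≤ a) + Multiset.replicate (κ.count 1) 1 :=
    eq_filter_two_le_add_replicate hκ
  constructor
  · intro h
    have := congrArg (Multiset.filter fun a => 2 ≤ a) h
    rw [fullCycleType, Multiset.filter_add, Multiset.filter_add,
      Multiset.filter_eq_self.2 fun _ => Equiv.Perm.two_le_of_mem_cycleType] at this
    have h1 : ∀ r : ℕ, (Multiset.replicate r 1).filter (fun a => 2 ≤ a) = 0 := fun r =>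
      Multiset.filter_eq_nil.2 fun a ha => by rw [Multiset.eq_of_mem_replicate ha]; decide
    simpa [h1] using this
  · intro h
    have h1 := π.sum_cycleType
    have h2 := congrArg Multiset.sum hdec
    rw [Multiset.sum_add, ← h, h1, Multiset.sum_replicate, smul_eq_mul, mul_one] at h2
    rw [fullCycleType, h]
    conv_rhs => rw [hdec]
    rw [add_assoc, ← Multiset.replicate_add]
    congr 2
    omega

lemma card_fixingExtensions_nil_mul {V : Finset (Fin n)} {κ : Multiset ℕ}
    (hκ : ∀ a ∈ κ, 0 < a) (hsum : κ.sum + V.card = n) :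
    (fixingExtensions V [] κ).card * centralizerOrder κ = (n - V.card).factorial := by
  have hcard : Fintype.card {x : Fin n // x ∉ V} = n - V.card := by
    rw [Fintype.card_subtype_compl]; simp
  set κ' := κ.filter (fun a => 2 ≤ a) with hκ'
  have hdec : κ = κ' + Multiset.replicate (κ.count 1) 1 :=
    eq_filter_two_le_add_replicate hκ
  have h2 := congrArg Multiset.sum hdec
  rw [Multiset.sum_add, Multiset.sum_replicate, smul_eq_mul, mul_one] at h2
  have key := Equiv.Perm.card_of_cycleType_mul_eq {x : Fin n // x ∉ V} κ'
  rw [if_pos ⟨by omega, fun a ha => (Multiset.mem_filter.1 ha).2⟩, hcard] at key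
  rw [← key]
  congr 1
  · symm
    refine Finset.card_bij (fun τ _ => Equiv.Perm.ofSubtype τ) ?_ ?_ ?_
    · intro τ hτ
      rw [fixingExtensions, Finset.mem_filter]
      refine ⟨Finset.mem_univ _, fun x hx => ?_, by simp, ?_⟩
      · exact Equiv.Perm.ofSubtype_apply_of_not_mem τ (by simpa using hx)
      · rw [fullCycleType_eq_iff hκ hsum, Equiv.Perm.cycleType_ofSubtype]
        exact (Finset.mem_filter.1 hτ).2
    · intro τ _ τ' _ h
      exact Equiv.Perm.ofSubtype_injective h
    · intro π hπ
      rw [fixingExtensions, Finset.mem_filter] at hπ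
      obtain ⟨-, hfix, -, hπ⟩ := hπ
      let e := Equiv.Perm.subtypeEquivSubtypePerm (fun x : Fin n => x ∉ V)
      have he : Equiv.Perm.ofSubtype (e.symm ⟨π, fun a ha => hfix a (by simpa using ha)⟩) = π :=
        congrArg Subtype.val (e.apply_symm_apply ⟨π, fun a ha => hfix a (by simpa using ha)⟩)
      refine ⟨_, ?_, he⟩
      rw [Finset.mem_filter]
      refine ⟨Finset.mem_univ _, ?_⟩
      rw [← Equiv.Perm.cycleType_ofSubtype, he]
      exact (fullCycleType_eq_iff hκ hsum π).1 hπ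
  · have h1 : 1 ∉ κ' := by simp [hκ']
    rw [hdec, centralizerOrder_add_replicate_one h1, centralizerOrder,
      show n - V.card - κ'.sum = κ.count 1 by omega]
    ring

lemma follows_append_self_iff {π : Equiv.Perm (Fin n)} {c : List (Fin n)} (hc : c.Nodup) :
    Follows π (c ++ c) ↔ ∀ x ∈ c, π x = c.formPerm x := by
  rcases eq_or_ne c [] with rfl | h0
  · simp [Follows]
  have hpos : 0 < c.length := List.length_pos_of_ne_nil h0
  have hform := fun i (hi : i < c.length) => List.formPerm_apply_getElem c hc i hi
  constructor
  · intro h x hx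
    obtain ⟨h1, -, h2⟩ := (follows_append_of_ne_nil h0 h0).1 h
    obtain ⟨i, hi, rfl⟩ := List.getElem_of_mem hx
    rw [hform i hi]
    rcases Nat.lt_or_ge (i + 1) c.length with h3 | h3
    · simp only [Nat.mod_eq_of_lt h3]
      exact List.isChain_iff_getElem.1 h1 i h3
    · have : i = c.length - 1 := by omega
      subst this
      rw [List.head?_eq_getElem?, List.getElem?_eq_getElem hpos, Option.some_inj,
        List.getLast_eq_getElem] at h2
      simp only [Nat.sub_add_cancel hpos, Nat.mod_self, ← h2]
  · intro h
    have h1 : Follows π c := List.isChain_iff_getElem.2 fun i hi => by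
      rw [h _ (List.getElem_mem _), hform i (by omega)]
      simp only [Nat.mod_eq_of_lt hi]
    refine (follows_append_of_ne_nil h0 h0).2 ⟨h1, h1, ?_⟩
    rw [h _ (List.getLast_mem h0), List.head?_eq_getElem?, List.getElem?_eq_getElem hpos,
      Option.some_inj, List.getLast_eq_getElem, hform _ (by omega)]
    simp only [Nat.sub_add_cancel hpos, Nat.mod_self]

lemma follows_congr {π τ : Equiv.Perm (Fin n)} {l : List (Fin n)} (h : ∀ x ∈ l, π x = τ x) :
    Follows π l ↔ Follows τ l := by
  constructor <;> intro hl <;>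
    exact List.IsChain.imp_of_mem_imp (fun a b ha _ hab => by simpa [h a ha] using hab) hl

lemma fullCycleType_formPerm_mul {c : List (Fin n)} (h0 : c ≠ []) (hcn : c.Nodup)
    {τ : Equiv.Perm (Fin n)} (hτ : ∀ x ∈ c, τ x = x) :
    fullCycleType (c.formPerm * τ) + Multiset.replicate c.length 1 =
      c.length ::ₘ fullCycleType τ := by
  have hd : c.formPerm.Disjoint τ := fun x => by
    by_cases hx : x ∈ c
    · exact Or.inr (hτ x hx)
    · exact Or.inl (List.formPerm_apply_of_notMem hx)
  have hle : c.length ≤ n := by simpa using hcn.length_le_card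
  have h4 := fullCycleType_mul hd
  rw [fullCycleType_formPerm hcn h0] at h4
  have h5 : Multiset.replicate n 1 =
      Multiset.replicate (n - c.length) 1 + Multiset.replicate c.length 1 := by
    rw [← Multiset.replicate_add, Nat.sub_add_cancel hle]
  rw [h5, Multiset.cons_add, ← Multiset.singleton_add] at h4
  rw [← Multiset.singleton_add]
  refine add_left_cancel (a := Multiset.replicate (n - c.length) 1) ?_
  calc _ = _ := by abel
    _ = _ := h4
    _ = _ := by abel

lemma replicate_le_fullCycleType {W : Finset (Fin n)} {τ : Equiv.Perm (Fin n)}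
    (hτ : ∀ x ∈ W, τ x = x) : Multiset.replicate W.card 1 ≤ fullCycleType τ := by
  refine le_trans (Multiset.replicate_le_replicate 1 |>.2 ?_) (Multiset.le_add_left _ _)
  have hd : Disjoint W τ.support := Finset.disjoint_left.2 fun x hx => by simp [hτ x hx]
  have := (W ∪ τ.support).card_le_univ
  rw [Finset.card_union_of_disjoint hd, Fintype.card_fin] at this
  omega

lemma card_union_toFinset {V : Finset (Fin n)} {c : List (Fin n)} (hcn : c.Nodup)
    (hV : ∀ x ∈ c, x ∉ V) : (V ∪ c.toFinset).card = V.card + c.length := by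
  rw [Finset.card_union_of_disjoint, List.toFinset_card_of_nodup hcn]
  exact Finset.disjoint_right.2 fun x hx => hV x (by simpa using hx)

lemma apply_eq_self_of_follows {c : List (Fin n)} (hcn : c.Nodup) {τ : Equiv.Perm (Fin n)} :
    Follows (c.formPerm * τ) (c ++ c) ↔ ∀ x ∈ c, τ x = x := by
  rw [follows_append_self_iff hcn]
  simp

lemma mul_mem_fixingExtensions_iff {V : Finset (Fin n)} {c : List (Fin n)}
    {cs : List (List (Fin n))} {κ : Multiset ℕ} (h0 : c ≠ []) (hnd : (c :: cs).flatten.Nodup)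
    (hV : ∀ x ∈ (c :: cs).flatten, x ∉ V) (hc : c.length ∈ κ) (τ : Equiv.Perm (Fin n)) :
    c.formPerm * τ ∈ fixingExtensions V (c :: cs) κ ↔
      τ ∈ fixingExtensions (V ∪ c.toFinset) cs (κ.erase c.length) := by
  rw [List.flatten_cons, List.nodup_append] at hnd
  obtain ⟨hcn, -, hdisj⟩ := hnd
  have hcV : ∀ x ∈ c, x ∉ V := fun x hx => hV x (by simp [hx])
  have hcy : Follows (c.formPerm * τ) (c ++ c) ↔ ∀ x ∈ c, τ x = x :=
    apply_eq_self_of_follows hcn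
  have hcard := card_union_toFinset hcn hcV
  simp only [fixingExtensions, Finset.mem_filter, Finset.mem_univ, true_and, List.forall_mem_cons,
    hcy, hcard]
  have hfix : (∀ x ∈ V ∪ c.toFinset, τ x = x) ↔ (∀ x ∈ V, τ x = x) ∧ ∀ x ∈ c, τ x = x := by
    simp only [Finset.mem_union, List.mem_toFinset, or_imp, forall_and]
  rw [hfix]
  by_cases hτ : ∀ x ∈ c, τ x = x
  swap
  · simp [hτ]
  have heq : ∀ x ∉ c, (c.formPerm * τ) x = τ x := by
    intro x hx
    refine List.formPerm_apply_of_notMem fun h => hx ?_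
    rwa [← τ.injective (hτ _ h)]
  have h1 : (∀ x ∈ V, (c.formPerm * τ) x = x) ↔ ∀ x ∈ V, τ x = x :=
    forall₂_congr fun x hx => by rw [heq x fun h => hcV x h hx]
  have h2 : (∀ d ∈ cs, Follows (c.formPerm * τ) (d ++ d)) ↔ ∀ d ∈ cs, Follows τ (d ++ d) :=
    forall₂_congr fun d hd => follows_congr fun x hx => heq x fun h =>
      hdisj x h x (List.mem_flatten.2 ⟨d, hd, by simpa using hx⟩) rfl
  have h3 : fullCycleType (c.formPerm * τ) = κ + Multiset.replicate V.card 1 ↔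
      fullCycleType τ = κ.erase c.length + Multiset.replicate (V.card + c.length) 1 := by
    have h6 := fullCycleType_formPerm_mul h0 hcn hτ
    constructor
    · intro h
      rw [h] at h6
      rw [← Multiset.cons_inj_right c.length, ← h6, ← Multiset.cons_add, Multiset.cons_erase hc,
        Multiset.replicate_add, add_assoc]
    · intro h
      rw [h, ← Multiset.cons_add, Multiset.cons_erase hc, Multiset.replicate_add,
        ← add_assoc] at h6
      exact add_right_cancel h6
  rw [h1, h2, h3]
  tauto

lemma card_fixingExtensions_cons {V : Finset (Fin n)} {c : List (Fin n)}
    {cs : List (List (Fin n))} {κ : Multiset ℕ} (h0 : c ≠ []) (hnd : (c :: cs).flatten.Nodup)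
    (hV : ∀ x ∈ (c :: cs).flatten, x ∉ V) :
    (fixingExtensions V (c :: cs) κ).card = if c.length ∈ κ then
      (fixingExtensions (V ∪ c.toFinset) cs (κ.erase c.length)).card else 0 := by
  split_ifs with hc
  · symm
    exact Finset.card_equiv (Equiv.mulLeft c.formPerm) fun τ =>
      (mul_mem_fixingExtensions_iff h0 hnd hV hc τ).symm
  · rw [Finset.card_eq_zero, Finset.eq_empty_iff_forall_notMem]
    intro π hπ
    simp only [fixingExtensions, Finset.mem_filter, Finset.mem_univ, true_and,
      List.forall_mem_cons] at hπ
    obtain ⟨hfix, ⟨hcy, -⟩, hfull⟩ := hπ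
    rw [List.flatten_cons, List.nodup_append] at hnd
    have hcV : ∀ x ∈ c, x ∉ V := fun x hx => hV x (by simp [hx])
    obtain ⟨τ, rfl⟩ : ∃ τ, π = c.formPerm * τ := ⟨c.formPerm⁻¹ * π, by simp⟩
    rw [apply_eq_self_of_follows hnd.1] at hcy
    have hle : Multiset.replicate (V ∪ c.toFinset).card 1 ≤ fullCycleType τ := by
      refine replicate_le_fullCycleType fun x hx => ?_
      rcases Finset.mem_union.1 hx with hx | hx
      · refine c.formPerm.injective ?_
        rw [← Equiv.Perm.mul_apply, hfix x hx,
          List.formPerm_apply_of_notMem fun h => hcV x h hx]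
      · exact hcy x (by simpa using hx)
    obtain ⟨ρ, hρ⟩ := Multiset.le_iff_exists_add.1 hle
    have h6 := fullCycleType_formPerm_mul h0 hnd.1 hcy
    rw [hρ, hfull, card_union_toFinset hnd.1 hcV, Multiset.replicate_add, ← Multiset.add_cons,
      add_assoc, add_comm κ] at h6
    rw [add_left_cancel h6] at hc
    exact hc (Multiset.mem_cons_self _ _)

lemma card_fixingExtensions_mul (cs : List (List (Fin n))) :
    ∀ (V : Finset (Fin n)) (κ : Multiset ℕ), (∀ c ∈ cs, c ≠ []) → cs.flatten.Nodup →
      (∀ x ∈ cs.flatten, x ∉ V) → (∀ a ∈ κ, 0 < a) → κ.sum + V.card = n →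
      (fixingExtensions V cs κ).card * centralizerOrder (κ - ↑(cs.map List.length)) =
        if (↑(cs.map List.length) : Multiset ℕ) ≤ κ then
          (n - V.card - cs.flatten.length).factorial else 0 := by
  induction cs with
  | nil =>
    intro V κ _ _ _ hκ hsum
    simpa using card_fixingExtensions_nil_mul hκ hsum
  | cons c cs ih =>
    intro V κ h0 hnd hV hκ hsum
    rw [card_fixingExtensions_cons (h0 c List.mem_cons_self) hnd hV]
    rw [List.map_cons, ← Multiset.cons_coe, Multiset.sub_cons]
    by_cases hc : c.length ∈ κ
    · have hnd' := hnd
      rw [List.flatten_cons, List.nodup_append] at hnd'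
      have hcard := card_union_toFinset hnd'.1 (V := V) fun x hx => hV x (by simp [hx])
      have hs : (κ.erase c.length).sum + (V ∪ c.toFinset).card = n := by
        have := Multiset.sum_erase hc
        omega
      rw [if_pos hc, ih _ _ (fun d hd => h0 d (List.mem_cons_of_mem _ hd)) hnd'.2.1 ?_
        (fun a ha => hκ a (Multiset.mem_of_mem_erase ha)) hs, hcard]
      · have : (c.length ::ₘ (↑(cs.map List.length) : Multiset ℕ) ≤ κ) ↔
            (↑(cs.map List.length) : Multiset ℕ) ≤ κ.erase c.length := by
          conv_lhs => rw [← Multiset.cons_erase hc]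
          exact Multiset.cons_le_cons_iff _
        simp only [this, List.flatten_cons, List.length_append, Nat.sub_sub, add_assoc]
      · intro x hx hx'
        rcases Finset.mem_union.1 hx' with h | h
        · exact hV x (by rw [List.flatten_cons]; exact List.mem_append_right _ hx) h
        · exact hnd'.2.2 x (by simpa using h) x hx rfl
    · rw [if_neg hc, zero_mul, if_neg]
      exact fun h => hc (Multiset.mem_of_le h (Multiset.mem_cons_self _ _))

end CycleType

section Base

variable {n : ℕ}

/-- The product `∏ a * (count a κ - j)`, where the entry `a` of the list is preceded (from the right)
by `j` equal entries. -/
def cycleFactor (κ : Multiset ℕ) : List ℕ → ℤ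
  | [] => 1
  | a :: l => cycleFactor κ l * (a * ((κ.count a : ℤ) - l.count a))

lemma cycleFactor_mul_centralizerOrder {κ : Multiset ℕ} (hκ : ∀ a ∈ κ, 0 < a)
    (l : List ℕ) :
    cycleFactor κ l * centralizerOrder (κ - ↑l) =
      if (↑l : Multiset ℕ) ≤ κ then (centralizerOrder κ : ℤ) else 0 := by
  induction l with
  | nil => simp [cycleFactor]
  | cons a l ih =>
    have hsub : κ - ↑(a :: l) = (κ - ↑l).erase a := by
      rw [← Multiset.cons_coe, ← Multiset.singleton_add, add_comm, tsub_add_eq_tsub_tsub,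
        Multiset.sub_singleton]
    have hle : (↑(a :: l) : Multiset ℕ) ≤ κ ↔ (↑l : Multiset ℕ) ≤ κ ∧ a ∈ κ - ↑l := by
      rw [← Multiset.cons_coe, Multiset.mem_sub]
      constructor
      · intro h
        exact ⟨(Multiset.le_cons_self _ _).trans h, lt_of_lt_of_le (by simp)
          (Multiset.count_le_of_le a h)⟩
      · rintro ⟨h1, h2⟩
        rw [Multiset.le_iff_count] at h1 ⊢
        intro b
        rcases eq_or_ne b a with rfl | hb
        · rw [Multiset.count_cons_self]; omega
        · rw [Multiset.count_cons_of_ne hb]; exact h1 b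
    rw [hsub, cycleFactor]
    by_cases h1 : (↑l : Multiset ℕ) ≤ κ
    swap
    · rw [if_neg h1] at ih
      rw [if_neg fun h => h1 (hle.1 h).1]
      have hpos := centralizerOrder_pos fun b hb =>
        hκ b (Multiset.mem_of_le (Multiset.sub_le_self κ ↑l) hb)
      rw [(mul_eq_zero.1 ih).resolve_right (by exact_mod_cast hpos.ne'), zero_mul, zero_mul]
    by_cases h2 : a ∈ κ - ↑l
    · rw [if_pos (hle.2 ⟨h1, h2⟩), ← (if_pos h1 : _ = (centralizerOrder κ : ℤ)), ← ih]
      conv_rhs => rw [← Multiset.cons_erase h2]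
      rw [centralizerOrder_cons, ← Multiset.count_cons_self, Multiset.cons_erase h2,
        Multiset.count_sub, Multiset.coe_count]
      have h3 := Multiset.count_le_of_le a h1
      rw [Multiset.coe_count] at h3
      push_cast [Nat.cast_sub h3]
      ring
    · rw [if_neg fun h => h2 (hle.1 h).2]
      rw [Multiset.mem_sub, Multiset.coe_count, not_lt] at h2
      have h3 := Multiset.count_le_of_le a h1
      rw [Multiset.coe_count] at h3
      rw [le_antisymm h3 h2]
      simp

lemma extCount_eq_card_fixingExtensions (lam : Nat.Partition n) (cs : List (List (Fin n))) :
    extCount lam cs [] = (fixingExtensions ∅ cs lam.parts).card := by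
  rw [extCount, KClass, Finset.filter_filter, fixingExtensions]
  congr 1
  ext π
  simp [Extends, and_comm]

lemma extCount_nil_nil (lam : Nat.Partition n) : extCount lam [] [] = (KClass lam).card := by
  simp [extCount, Extends]

lemma card_KClass_mul (lam : Nat.Partition n) :
    (KClass lam).card * centralizerOrder lam.parts = n.factorial := by
  rw [← extCount_nil_nil, extCount_eq_card_fixingExtensions]
  simpa using card_fixingExtensions_nil_mul (V := (∅ : Finset (Fin n)))
    (fun _ h => lam.parts_pos h) (by simp [lam.parts_sum])

lemma card_KClass_pos (lam : Nat.Partition n) : 0 < (KClass lam).card :=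
  Nat.pos_of_mul_pos_right ((card_KClass_mul lam).symm ▸ n.factorial_pos)

lemma descFactorial_mul_extCount_nil (lam : Nat.Partition n) {cs : List (List (Fin n))}
    (h0 : ∀ c ∈ cs, c ≠ []) (hnd : cs.flatten.Nodup) :
    (n.descFactorial cs.flatten.length : ℤ) * extCount lam cs [] =
      cycleFactor lam.parts (cs.map List.length) * (KClass lam).card := by
  have hκ : ∀ a ∈ lam.parts, 0 < a := fun _ h => lam.parts_pos h
  have hpos : ((centralizerOrder (lam.parts - ↑(cs.map List.length)) : ℕ) : ℤ) ≠ 0 := by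
    exact_mod_cast (centralizerOrder_pos fun b hb =>
      hκ b (Multiset.mem_of_le (Multiset.sub_le_self _ _) hb)).ne'
  have h1 := cycleFactor_mul_centralizerOrder hκ (cs.map List.length)
  have h2 := card_fixingExtensions_mul cs ∅ lam.parts h0 hnd (by simp) hκ (by simp [lam.parts_sum])
  have h3 := card_KClass_mul lam
  rw [← extCount_eq_card_fixingExtensions] at h2
  have hle : cs.flatten.length ≤ n := by simpa using hnd.length_le_card
  have h4 := Nat.factorial_mul_descFactorial hle
  refine mul_right_cancel₀ hpos ?_
  split_ifs at h1 h2
  · rw [mul_assoc, mul_right_comm, h1]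
    rw [mul_comm] at h4
    have h2' : (extCount lam cs [] : ℤ) * centralizerOrder (lam.parts - ↑(cs.map List.length)) =
        (n - cs.flatten.length).factorial := by
      rw [Finset.card_empty, Nat.sub_zero] at h2
      exact_mod_cast h2
    rw [h2', mul_comm (centralizerOrder lam.parts : ℤ)]
    exact_mod_cast h4.trans h3.symm
  · rw [mul_assoc, mul_right_comm, h1]
    have h2' : (extCount lam cs [] : ℤ) * centralizerOrder (lam.parts - ↑(cs.map List.length)) =
        0 := by exact_mod_cast h2
    rw [h2', mul_zero, zero_mul]

end Base

section Degree

/-- The weighted degree of `F` in which the variable `0` has degree `1` and the variable `i ≥ 1` has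
degree `i` is at most `d`. -/
def DegreeLE (F : MvPolynomial ℕ ℤ) (d : ℕ) : Prop :=
  F.weightedTotalDegree (fun i => max i 1) ≤ d

variable {F G : MvPolynomial ℕ ℤ} {d e : ℕ}

lemma degreeLE_iff :
    DegreeLE F d ↔ ∀ s ∈ F.support, Finsupp.weight (fun i : ℕ => max i 1) s ≤ d :=
  Finset.sup_le_iff

lemma DegreeLE.mono (h : DegreeLE F d) (hde : d ≤ e) : DegreeLE F e :=
  le_trans h hde

lemma DegreeLE.add (hF : DegreeLE F d) (hG : DegreeLE G d) : DegreeLE (F + G) d := by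
  rw [degreeLE_iff] at *
  intro s hs
  exact (Finset.mem_union.1 (MvPolynomial.support_add hs)).elim (hF s) (hG s)

lemma DegreeLE.sub (hF : DegreeLE F d) (hG : DegreeLE G d) : DegreeLE (F - G) d := by
  rw [sub_eq_add_neg]
  refine hF.add ?_
  rw [degreeLE_iff] at *
  simpa using hG

lemma DegreeLE.mul (hF : DegreeLE F d) (hG : DegreeLE G e) : DegreeLE (F * G) (d + e) := by
  rw [degreeLE_iff] at *
  intro s hs
  obtain ⟨a, ha, b, hb, rfl⟩ := Finset.mem_add.1 (MvPolynomial.support_mul F G hs)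
  rw [map_add]
  exact add_le_add (hF a ha) (hG b hb)

lemma degreeLE_C (a : ℤ) : DegreeLE (MvPolynomial.C a) d := by
  rw [degreeLE_iff]
  intro s hs
  rw [MvPolynomial.support_C] at hs
  split_ifs at hs
  · simp at hs
  · rw [Finset.mem_singleton.1 hs, map_zero]
    exact Nat.zero_le _

lemma degreeLE_X (i : ℕ) : DegreeLE (MvPolynomial.X i) (max i 1) := by
  rw [degreeLE_iff]
  intro s hs
  rw [MvPolynomial.support_X, Finset.mem_singleton] at hs
  simp [hs, Finsupp.weight_single]

lemma degreeLE_sum {ι : Type*} (s : Finset ι) {f : ι → MvPolynomial ℕ ℤ}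
    (h : ∀ i ∈ s, DegreeLE (f i) d) : DegreeLE (∑ i ∈ s, f i) d :=
  Finset.sum_induction f (DegreeLE · d) (fun _ _ => DegreeLE.add)
    (by simpa using degreeLE_C (d := d) 0) h

lemma DegreeLE.vars_subset (h : DegreeLE F d) : F.vars ⊆ Finset.range (d + 1) := by
  intro i hi
  obtain ⟨s, hs, his⟩ := (MvPolynomial.mem_vars_iff_mem_support i).1 hi
  have h1 := degreeLE_iff.1 h s hs
  have h2 := Finsupp.le_weight_of_ne_zero' (fun i : ℕ => max i 1) (Finsupp.mem_support_iff.1 his)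
  have h3 : i ≤ max i 1 := le_max_left _ _
  exact Finset.mem_range.2 (by omega)

end Degree

section Polynomial

open MvPolynomial

/-- The point `(n, m_1(λ), m_2(λ), …)`. -/
def multiplicities {n : ℕ} (lam : Nat.Partition n) : ℕ → ℤ :=
  fun i => if i = 0 then (n : ℤ) else (Multiset.count i lam.parts : ℤ)

lemma exists_cyclePolynomial (l : List ℕ) (hl : ∀ a ∈ l, 0 < a) :
    ∃ F : MvPolynomial ℕ ℤ, DegreeLE F l.sum ∧
      ∀ (n : ℕ) (lam : Nat.Partition n), eval (multiplicities lam) F = cycleFactor lam.parts l := by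
  induction l with
  | nil => exact ⟨C 1, degreeLE_C 1, fun n lam => by simp [cycleFactor]⟩
  | cons a l ih =>
    rw [List.forall_mem_cons] at hl
    obtain ⟨F, hF, hF'⟩ := ih hl.2
    refine ⟨F * (C (a : ℤ) * (X a - C (l.count a : ℤ))), ?_, fun n lam => ?_⟩
    · have h1 : DegreeLE (C (a : ℤ) * (X a - C (l.count a : ℤ))) (0 + max a 1) :=
        (degreeLE_C _).mul ((degreeLE_X a).sub (degreeLE_C _))
      refine (hF.mul h1).mono ?_
      have := hl.1
      rw [List.sum_cons]
      omega
    · simp [hF', cycleFactor, multiplicities, hl.1.ne']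

lemma getD_map_length {α : Type*} (ps : List (List α)) (i : ℕ) :
    (ps.map List.length).getD i 0 = (ps.getD i []).length :=
  List.getD_map ps [] List.length

lemma sum_map_getD_add_eraseIdx (f : ℕ → ℕ) {ν : List ℕ} {i : ℕ} (hi : i < ν.length) :
    f (ν.getD i 0) + ((ν.eraseIdx i).map f).sum = (ν.map f).sum := by
  have h := ((List.getElem_cons_eraseIdx_perm hi).map f).sum_eq
  simpa [hi] using h

/-- The weight of a list of numbers of vertices of paths: a path contributes its number of edges,
and `1` if it has no edges. -/
def pathWeight (ν : List ℕ) : ℕ := (ν.map fun b => max (b - 1) 1).sum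

/-- `F` computes the normalized number of permutations of cycle type `λ` extending a configuration of
cycles of lengths `μ` and paths with numbers of vertices `ν`. -/
def Computes (F : MvPolynomial ℕ ℤ) (μ ν : List ℕ) : Prop :=
  ∀ (n : ℕ) (lam : Nat.Partition n) (cs ps : List (List (Fin n))),
    cs.map List.length = μ → ps.map List.length = ν → (cs.flatten ++ ps.flatten).Nodup →
      (n.descFactorial (μ.sum + ν.sum) : ℤ) * extCount lam cs ps =
        eval (multiplicities lam) F * (KClass lam).card

lemma computes_isolated {F : MvPolynomial ℕ ℤ} {μ ν : List ℕ} (hF : Computes F μ ν) :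
    Computes (F * (X 0 - C ((μ.sum + ν.sum : ℕ) : ℤ))) μ (1 :: ν) := by
  intro n lam cs ps hcs hps hnd
  rcases ps with _ | ⟨p, ps⟩
  · simp at hps
  rw [List.map_cons, List.cons.injEq] at hps
  obtain ⟨x, rfl⟩ := List.length_eq_one_iff.1 hps.1
  have hsub : (cs.flatten ++ ps.flatten).Nodup :=
    hnd.sublist (List.Sublist.append_left (by simp) _)
  have hext : extCount lam cs ([x] :: ps) = extCount lam cs ps := by
    have : ∀ π : Equiv.Perm (Fin n), Follows π [x] := fun π => List.isChain_singleton x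
    unfold extCount
    congr 1
    ext π
    rw [Finset.mem_filter, Finset.mem_filter]
    simp [Extends, this]
  have hle : μ.sum + ν.sum ≤ n := by
    have := hsub.length_le_card
    simpa [List.length_flatten, hcs, hps.2] using this
  have key := hF n lam cs ps hcs hps.2 hsub
  rw [hext, List.sum_cons, show μ.sum + (1 + ν.sum) = μ.sum + ν.sum + 1 by ring,
    Nat.descFactorial_succ, Nat.cast_mul, Nat.cast_sub hle, mul_assoc, key]
  simp only [eval_mul, eval_sub, eval_X, eval_C, multiplicities, if_true]
  ring

lemma computes_step {μ ν : List ℕ} {l : ℕ} {F G : MvPolynomial ℕ ℤ} {H : ℕ → MvPolynomial ℕ ℤ}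
    (hν : ∀ b ∈ ν, 0 < b)
    (hF : Computes F μ ((l + 1) :: ν)) (hG : Computes G ((l + 1) :: μ) ν)
    (hH : ∀ i ∈ Finset.range ν.length, Computes (H i) μ ((l + 1 + ν.getD i 0) :: ν.eraseIdx i)) :
    Computes (F - G - ∑ i ∈ Finset.range ν.length, H i) μ ((l + 2) :: ν) := by
  intro n lam cs ps hcs hps hnd
  rcases ps with _ | ⟨p, ps⟩
  · simp at hps
  rw [List.map_cons, List.cons.injEq] at hps
  obtain ⟨hp, rfl⟩ := hps
  obtain ⟨q, v, rfl⟩ : ∃ q v, p = q ++ [v] :=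
    ⟨p.dropLast, p.getLast (by rintro rfl; simp at hp), (List.dropLast_append_getLast _).symm⟩
  have hql : q.length = l + 1 := by simpa using hp
  have hq : q ≠ [] := by rintro rfl; simp at hql
  have hperm : (cs.flatten ++ ((q ++ [v]) :: ps).flatten).Perm
      (v :: (cs.flatten ++ (q :: ps).flatten)) := by
    simp only [List.flatten_cons]
    rw [show cs.flatten ++ (q ++ [v] ++ ps.flatten) =
      (cs.flatten ++ q) ++ v :: ps.flatten by simp]
    simpa using List.perm_middle (a := v) (l₁ := cs.flatten ++ q) (l₂ := ps.flatten)
  have hnd' := hperm.nodup_iff.1 hnd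
  rw [List.nodup_cons] at hnd'
  obtain ⟨hv, hnd'⟩ := hnd'
  have hps0 : ∀ p ∈ ps, p ≠ [] := by
    rintro p hp rfl
    exact absurd (hν 0 (List.mem_map.2 ⟨[], hp, rfl⟩)) (lt_irrefl 0)
  have hrec := extCount_recursion lam hq hps0 hnd' hv
  set ν := ps.map List.length with hνdef
  have hlen : (cs.flatten ++ (q :: ps).flatten).length = μ.sum + ((l + 1) :: ν).sum := by
    simp [List.length_flatten, hcs, hql, hνdef]
  have hle : μ.sum + ((l + 1) :: ν).sum ≤ n := by
    rw [← hlen]; simpa using hnd'.length_le_card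
  rw [hlen] at hrec
  have h1 := hF n lam cs (q :: ps) hcs (by simp [hql, hνdef]) hnd'
  have h2 := hG n lam (q :: cs) ps (by simp [hql, hcs]) rfl (by
    refine (List.Perm.nodup_iff ?_).1 hnd'
    simp only [List.flatten_cons]
    rw [← List.append_assoc]
    exact List.perm_append_comm.append_right _)
  have h3 : ∀ i ∈ Finset.range ν.length,
      (n.descFactorial (μ.sum + ((l + 1) :: ν).sum) : ℤ) *
        extCount lam cs ((q ++ ps.getD i []) :: ps.eraseIdx i) =
        eval (multiplicities lam) (H i) * (KClass lam).card := by
    intro i hi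
    have hi' : i < ν.length := Finset.mem_range.1 hi
    have hi'' : i < ps.length := by simpa [hνdef] using hi'
    have hsum : μ.sum + ((l + 1 + ν.getD i 0) :: ν.eraseIdx i).sum =
        μ.sum + ((l + 1) :: ν).sum := by
      have := sum_map_getD_add_eraseIdx id hi'
      simp only [List.map_id, id] at this
      simp only [List.sum_cons]
      omega
    rw [← hsum]
    refine hH i hi n lam cs _ hcs ?_ ?_
    · rw [List.map_cons, List.length_append, hql, ← getD_map_length, List.eraseIdx_map]
    · refine (List.Perm.nodup_iff ?_).1 hnd'
      refine List.Perm.append_left _ ?_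
      simp only [List.flatten_cons, List.append_assoc]
      refine List.Perm.append_left _ ?_
      have h := (List.getElem_cons_eraseIdx_perm hi'').flatten
      simpa [hi''] using h.symm
  have hd : n.descFactorial (μ.sum + ((l + 2) :: ν).sum) =
      (n - (μ.sum + ((l + 1) :: ν).sum)) * n.descFactorial (μ.sum + ((l + 1) :: ν).sum) := by
    rw [← Nat.descFactorial_succ]
    congr 1
    simp only [List.sum_cons]
    ring
  have hlen' : ps.length = ν.length := by simp [hνdef]
  rw [hlen'] at hrec
  have hrec' : (extCount lam cs (q :: ps) : ℤ) = extCount lam (q :: cs) ps +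
      (∑ i ∈ Finset.range ν.length,
        (extCount lam cs ((q ++ ps.getD i []) :: ps.eraseIdx i) : ℤ)) +
      ((n - (μ.sum + ((l + 1) :: ν).sum) : ℕ) : ℤ) * extCount lam cs ((q ++ [v]) :: ps) := by
    exact_mod_cast hrec
  have h3' := Finset.sum_congr rfl h3
  rw [← Finset.mul_sum, ← Finset.sum_mul] at h3'
  have h2' : ((l + 1) :: μ).sum + ν.sum = μ.sum + ((l + 1) :: ν).sum := by
    simp only [List.sum_cons]; ring
  rw [h2'] at h2
  rw [hd]
  simp only [eval_sub, map_sum, Nat.cast_mul]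
  rw [hrec'] at h1
  linear_combination h1 - h2 - h3'

lemma exists_computes (N : ℕ) : ∀ μ ν : List ℕ, ν.sum = N → (∀ a ∈ μ, 0 < a) → (∀ b ∈ ν, 0 < b) →
    ∃ F, DegreeLE F (μ.sum + pathWeight ν) ∧ Computes F μ ν := by
  induction N using Nat.strong_induction_on with
  | _ N ih =>
  rintro μ (_ | ⟨L, ν⟩) hN hμ hν
  · obtain ⟨F, hF, hF'⟩ := exists_cyclePolynomial μ hμ
    refine ⟨F, by simpa [pathWeight] using hF, fun n lam cs ps hcs hps hnd => ?_⟩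
    obtain rfl : ps = [] := by simpa using hps
    have h0 : ∀ c ∈ cs, c ≠ [] := by
      rintro c hc rfl
      exact absurd (hμ 0 (hcs ▸ List.mem_map.2 ⟨[], hc, rfl⟩)) (lt_irrefl 0)
    have h := descFactorial_mul_extCount_nil lam h0 (by simpa using hnd)
    rw [List.length_flatten, hcs] at h
    simpa [hF'] using h
  rw [List.forall_mem_cons] at hν
  rw [List.sum_cons] at hN
  obtain ⟨hL, hν⟩ := hν
  obtain rfl | ⟨l, rfl⟩ : L = 1 ∨ ∃ l, L = l + 2 := by
    rcases L with _ | _ | l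
    · omega
    · exact Or.inl rfl
    · exact Or.inr ⟨l, rfl⟩
  · obtain ⟨F, hF, hF'⟩ := ih ν.sum (by omega) μ ν rfl hμ hν
    refine ⟨_, ?_, computes_isolated hF'⟩
    refine (hF.mul ((degreeLE_X 0).sub (degreeLE_C _))).mono ?_
    simp only [pathWeight, List.map_cons, List.sum_cons]
    omega
  · obtain ⟨F, hF, hF'⟩ := ih _ (by simp only [List.sum_cons]; omega) μ ((l + 1) :: ν) rfl hμ
      (List.forall_mem_cons.2 ⟨by omega, hν⟩)
    obtain ⟨G, hG, hG'⟩ := ih _ (by omega) ((l + 1) :: μ) ν rfl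
      (List.forall_mem_cons.2 ⟨by omega, hμ⟩) hν
    have hH : ∀ i, ∃ H, i ∈ Finset.range ν.length →
        DegreeLE H (μ.sum + pathWeight ((l + 1 + ν.getD i 0) :: ν.eraseIdx i)) ∧
          Computes H μ ((l + 1 + ν.getD i 0) :: ν.eraseIdx i) := by
      intro i
      by_cases hi : i ∈ Finset.range ν.length
      · have hsum := sum_map_getD_add_eraseIdx id (Finset.mem_range.1 hi)
        simp only [List.map_id, id] at hsum
        obtain ⟨H, hH⟩ := ih _ (by simp only [List.sum_cons]; omega) μ
          ((l + 1 + ν.getD i 0) :: ν.eraseIdx i) rfl hμ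
          (List.forall_mem_cons.2 ⟨by omega, fun b hb => hν b (List.mem_of_mem_eraseIdx hb)⟩)
        exact ⟨H, fun _ => hH⟩
      · exact ⟨0, fun h => absurd h hi⟩
    choose H hH using hH
    refine ⟨_, ?_, computes_step hν hF' hG' fun i hi => (hH i hi).2⟩
    refine ((hF.mono ?_).sub (hG.mono ?_)).sub (degreeLE_sum _ fun i hi => (hH i hi).1.mono ?_)
    · simp only [pathWeight, List.map_cons, List.sum_cons]
      omega
    · simp only [pathWeight, List.map_cons, List.sum_cons]
      omega
    · have hi' := Finset.mem_range.1 hi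
      have h1 := sum_map_getD_add_eraseIdx (fun b => max (b - 1) 1) hi'
      have h2 : 0 < ν.getD i 0 := by
        simpa [hi'] using hν _ (List.getElem_mem hi')
      simp only [pathWeight, List.map_cons, List.sum_cons]
      omega

end Polynomial

section Orbits

variable {n : ℕ} (σ : Equiv.Perm (Fin n)) (D : Finset (Fin n))

/-- The points whose orbit under `σ` stays in `D`. -/
noncomputable def core : Finset (Fin n) := Finset.univ.filter fun x => ∀ t, σ^[t] x ∈ D

/-- The smallest points of the orbits that stay in `D`. -/
noncomputable def coreReps : Finset (Fin n) := (core σ D).filter fun x => ∀ t, x ≤ σ^[t] x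

/-- The points of `D` whose preimage under `σ` is not in `D`. -/
noncomputable def starts : Finset (Fin n) := D.filter fun x => σ.symm x ∉ D

/-- The first time at which the orbit of `x` leaves `D`. -/
noncomputable def exitTime (x : Fin n) : ℕ := sInf {t | σ^[t] x ∉ D}

variable {σ D} {x y : Fin n} {a b t : ℕ}

lemma iterate_minimalPeriod_mul (x : Fin n) (t a : ℕ) :
    σ^[t + Function.minimalPeriod σ x * a] x = σ^[t] x := by
  rw [Function.iterate_add_apply,
    ((Function.isPeriodicPt_minimalPeriod σ x).mul_const a : _ = x)]

lemma minimalPeriod_pos (x : Fin n) : 0 < Function.minimalPeriod σ x :=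
  Function.minimalPeriod_pos_of_mem_periodicPts (σ.injective.mem_periodicPts x)

lemma mem_core : x ∈ core σ D ↔ ∀ t, σ^[t] x ∈ D := by simp [core]

lemma iterate_mem_core (h : x ∈ core σ D) (a : ℕ) : σ^[a] x ∈ core σ D :=
  mem_core.2 fun t => by rw [← Function.iterate_add_apply]; exact mem_core.1 h _

lemma mem_core_of_iterate (h : σ^[a] x ∈ core σ D) : x ∈ core σ D := by
  refine mem_core.2 fun t => ?_
  have h1 := mem_core.1 h (t + Function.minimalPeriod σ x * a - a)
  have h2 : a ≤ Function.minimalPeriod σ x * a := Nat.le_mul_of_pos_left a (minimalPeriod_pos x)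
  rwa [← Function.iterate_add_apply, Nat.sub_add_cancel (by omega),
    iterate_minimalPeriod_mul] at h1

lemma mem_starts : x ∈ starts σ D ↔ x ∈ D ∧ σ.symm x ∉ D := by simp [starts]

lemma notMem_core_of_mem_starts (h : x ∈ starts σ D) : x ∉ core σ D := fun hx =>
  (mem_starts.1 h).2 <| mem_core.1 (mem_core_of_iterate (σ := σ) (a := 1) (x := σ.symm x) (by simpa)) 0

lemma le_exitTime_iff (h : x ∉ core σ D) : t ≤ exitTime σ D x ↔ ∀ s < t, σ^[s] x ∈ D := by
  constructor
  · intro ht s hs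
    by_contra hD
    have : exitTime σ D x ≤ s := Nat.sInf_le hD
    omega
  · intro ht
    have hne : {t | σ^[t] x ∉ D}.Nonempty := by simpa [mem_core, Set.Nonempty] using h
    by_contra! hlt
    exact Nat.sInf_mem hne (ht _ hlt)

lemma iterate_mem_of_lt_exitTime (h : x ∉ core σ D) (ht : t < exitTime σ D x) : σ^[t] x ∈ D :=
  (le_exitTime_iff h).1 ht t t.lt_succ_self

lemma exitTime_pos (h : x ∈ starts σ D) : 0 < exitTime σ D x :=
  (le_exitTime_iff (notMem_core_of_mem_starts h)).2 fun s hs => by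
    obtain rfl : s = 0 := by omega
    exact (mem_starts.1 h).1

lemma eq_of_iterate_eq_start (hx : x ∈ starts σ D) (hy : y ∉ core σ D)
    (hb : b ≤ exitTime σ D y) (h : σ^[b] y = x) : b = 0 := by
  rcases b with _ | b
  · rfl
  · rw [Function.iterate_succ_apply'] at h
    refine absurd (iterate_mem_of_lt_exitTime hy hb) ?_
    have := (mem_starts.1 hx).2
    rwa [← h, Equiv.symm_apply_apply] at this

lemma start_iterate_injective (hx : x ∈ starts σ D) (hy : y ∈ starts σ D)
    (ha : a ≤ exitTime σ D x) (hb : b ≤ exitTime σ D y) (h : σ^[a] x = σ^[b] y) :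
    x = y ∧ a = b := by
  wlog hab : a ≤ b generalizing x y a b
  · obtain ⟨h1, h2⟩ := this hy hx hb ha h.symm (by omega)
    exact ⟨h1.symm, h2.symm⟩
  obtain ⟨c, rfl⟩ := Nat.exists_eq_add_of_le hab
  rw [Function.iterate_add_apply] at h
  have h' := σ.injective.iterate a h
  have hc := eq_of_iterate_eq_start hx (notMem_core_of_mem_starts hy) (by omega) h'.symm
  subst hc
  exact ⟨h', rfl⟩

lemma mem_coreReps : x ∈ coreReps σ D ↔ x ∈ core σ D ∧ ∀ t, x ≤ σ^[t] x := by simp [coreReps]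

lemma coreReps_eq_of_iterate (hx : x ∈ coreReps σ D) (hy : y ∈ coreReps σ D)
    (h : σ^[a] x = σ^[b] y) : x = y := by
  have key : ∀ {x y : Fin n} {a b : ℕ}, y ∈ coreReps σ D → σ^[a] x = σ^[b] y → y ≤ x := by
    intro x y a b hy h
    have h1 : a ≤ Function.minimalPeriod σ x * a := Nat.le_mul_of_pos_left a (minimalPeriod_pos x)
    have h2 := iterate_minimalPeriod_mul (σ := σ) x 0 a
    rw [zero_add, ← Nat.sub_add_cancel h1, Function.iterate_add_apply, h,
      ← Function.iterate_add_apply, Function.iterate_zero_apply] at h2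
    exact h2 ▸ (mem_coreReps.1 hy).2 _
  exact le_antisymm (key hx h.symm) (key hy h)

lemma exists_coreRep (hx : x ∈ core σ D) :
    ∃ r ∈ coreReps σ D, ∃ t < Function.minimalPeriod σ r, σ^[t] r = x := by
  obtain ⟨r, hr, hmin⟩ := Finset.exists_min_image
    (Finset.univ.filter fun y => ∃ t, σ^[t] y = x) id ⟨x, by simpa using ⟨0, rfl⟩⟩
  simp only [Finset.mem_filter, Finset.mem_univ, true_and, id] at hr hmin
  obtain ⟨t, rfl⟩ := hr
  refine ⟨r, mem_coreReps.2 ⟨mem_core_of_iterate hx, fun s => hmin _ ?_⟩,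
    t % Function.minimalPeriod σ r, Nat.mod_lt _ (minimalPeriod_pos r),
    Function.iterate_mod_minimalPeriod_eq⟩
  have h1 : s ≤ Function.minimalPeriod σ r * s := Nat.le_mul_of_pos_left s (minimalPeriod_pos r)
  refine ⟨t + Function.minimalPeriod σ r * s - s, ?_⟩
  rw [← Function.iterate_add_apply, Nat.sub_add_cancel (by omega), iterate_minimalPeriod_mul]

lemma exists_start (hx : x ∈ D) (hc : x ∉ core σ D) :
    ∃ s ∈ starts σ D, ∃ t < exitTime σ D s, σ^[t] s = x := by
  have hback : ∀ t, σ^[t] (σ.symm^[t] x) = x := fun t =>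
    Function.LeftInverse.iterate σ.apply_symm_apply t x
  have hex : ∃ t, σ.symm^[t] x ∉ D := by
    by_contra! hall
    refine hc (mem_core.2 fun a => ?_)
    have h1 : a ≤ Function.minimalPeriod σ x * a := Nat.le_mul_of_pos_left a (minimalPeriod_pos x)
    convert hall (Function.minimalPeriod σ x * a - a) using 1
    apply σ.injective.iterate (Function.minimalPeriod σ x * a - a)
    rw [hback, ← Function.iterate_add_apply, Nat.sub_add_cancel h1]
    simpa using iterate_minimalPeriod_mul (σ := σ) x 0 a
  have hpos : Nat.find hex ≠ 0 := fun h => by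
    have := Nat.find_spec hex
    rw [h] at this
    exact this hx
  obtain ⟨t, ht⟩ := Nat.exists_eq_succ_of_ne_zero hpos
  have hlt : ∀ u ≤ t, σ.symm^[u] x ∈ D := fun u hu => by
    by_contra h
    have := Nat.find_le (h := hex) h
    omega
  have hs : σ.symm^[t] x ∈ starts σ D := mem_starts.2 ⟨hlt t le_rfl, by
    have := Nat.find_spec hex
    rwa [ht, Function.iterate_succ_apply'] at this⟩
  refine ⟨_, hs, t, ?_, hback t⟩
  refine (le_exitTime_iff (notMem_core_of_mem_starts hs)).2 fun u hu => ?_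
  obtain ⟨v, rfl⟩ := Nat.exists_eq_add_of_le (Nat.le_of_lt_succ hu)
  rw [Function.iterate_add_apply, Function.LeftInverse.iterate σ.apply_symm_apply u]
  exact hlt v (by omega)

end Orbits

section Configuration

variable {n : ℕ} (σ : Equiv.Perm (Fin n)) (D : Finset (Fin n))

/-- The cycles of the restriction of `σ` to `D`. -/
noncomputable def cyclesOn : List (List (Fin n)) :=
  (coreReps σ D).toList.map fun r => List.iterate σ r (Function.minimalPeriod σ r)

/-- The maximal paths of the restriction of `σ` to `D`. -/
noncomputable def pathsOn : List (List (Fin n)) :=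
  (starts σ D).toList.map fun s => List.iterate σ s (exitTime σ D s + 1)

lemma flatten_cyclesOn : (cyclesOn σ D).flatten =
    (coreReps σ D).toList.flatMap fun r => List.iterate σ r (Function.minimalPeriod σ r) :=
  (List.flatMap_def ..).symm

lemma flatten_pathsOn : (pathsOn σ D).flatten =
    (starts σ D).toList.flatMap fun s => List.iterate σ s (exitTime σ D s + 1) :=
  (List.flatMap_def ..).symm

lemma nodup_iterate {α : Type*} {f : α → α} {x : α} {m : ℕ}
    (h : ∀ a < m, ∀ b < m, f^[a] x = f^[b] x → a = b) : (List.iterate f x m).Nodup := by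
  rw [List.nodup_iff_injective_get]
  intro i j hij
  have hi : i.1 < m := by simpa using i.2
  have hj : j.1 < m := by simpa using j.2
  simp only [List.get_eq_getElem, List.getElem_iterate] at hij
  exact Fin.ext (h _ hi _ hj hij)

variable {σ D}

lemma nodup_cyclesOn_append_pathsOn :
    ((cyclesOn σ D).flatten ++ (pathsOn σ D).flatten).Nodup := by
  rw [flatten_cyclesOn, flatten_pathsOn, List.nodup_append', List.nodup_flatMap, List.nodup_flatMap]
  refine ⟨⟨fun r _ => nodup_iterate fun a ha b hb h =>
      Function.iterate_injOn_Iio_minimalPeriod ha hb h,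
    (Finset.nodup_toList _).pairwise_of_forall_ne fun r hr r' hr' hne x hx hx' => hne ?_⟩,
    ⟨fun s hs => nodup_iterate fun a ha b hb h =>
      (start_iterate_injective (Finset.mem_toList.1 hs) (Finset.mem_toList.1 hs)
        (Nat.le_of_lt_succ ha) (Nat.le_of_lt_succ hb) h).2,
    (Finset.nodup_toList _).pairwise_of_forall_ne fun s hs s' hs' hne x hx hx' => hne ?_⟩,
    fun x hx hx' => ?_⟩
  · obtain ⟨a, -, rfl⟩ := List.mem_iterate.1 hx
    obtain ⟨b, -, h⟩ := List.mem_iterate.1 hx'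
    exact coreReps_eq_of_iterate (Finset.mem_toList.1 hr) (Finset.mem_toList.1 hr') h
  · obtain ⟨a, ha, rfl⟩ := List.mem_iterate.1 hx
    obtain ⟨b, hb, h⟩ := List.mem_iterate.1 hx'
    exact (start_iterate_injective (Finset.mem_toList.1 hs) (Finset.mem_toList.1 hs')
      (Nat.le_of_lt_succ ha) (Nat.le_of_lt_succ hb) h).1
  · obtain ⟨r, hr, hxr⟩ := List.mem_flatMap.1 hx
    obtain ⟨s, hs, hxs⟩ := List.mem_flatMap.1 hx'
    obtain ⟨a, -, rfl⟩ := List.mem_iterate.1 hxr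
    obtain ⟨b, -, h⟩ := List.mem_iterate.1 hxs
    have := iterate_mem_core (mem_coreReps.1 (Finset.mem_toList.1 hr)).1 a
    rw [h] at this
    exact notMem_core_of_mem_starts (Finset.mem_toList.1 hs) (mem_core_of_iterate this)

lemma follows_iterate {π : Equiv.Perm (Fin n)} {x : Fin n} {m : ℕ} :
    Follows π (List.iterate σ x (m + 1)) ↔ ∀ t < m, π (σ^[t] x) = σ (σ^[t] x) := by
  rw [Follows, List.isChain_iff_getElem]
  simp only [List.getElem_iterate, List.length_iterate, Nat.add_lt_add_iff_right,
    Function.iterate_succ_apply']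

lemma follows_iterate_cycle {π : Equiv.Perm (Fin n)} {x : Fin n} {m : ℕ} (hm : 0 < m)
    (h : σ^[m] x = x) :
    Follows π (List.iterate σ x m ++ List.iterate σ x m) ↔
      ∀ t < m, π (σ^[t] x) = σ (σ^[t] x) := by
  have h1 : List.iterate σ x m ++ List.iterate σ x m = List.iterate σ x (m + m) := by
    rw [List.iterate_add, h]
  rw [h1, show m + m = (m + m - 1) + 1 by omega, follows_iterate]
  refine ⟨fun H t ht => H t (by omega), fun H t ht => ?_⟩
  rcases lt_or_ge t m with h2 | h2
  · exact H t h2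
  · obtain ⟨s, rfl⟩ := Nat.exists_eq_add_of_le' h2
    rw [Function.iterate_add_apply, h]
    exact H s (by omega)

lemma extends_cyclesOn_pathsOn {π : Equiv.Perm (Fin n)} :
    Extends π (cyclesOn σ D) (pathsOn σ D) ↔ ∀ x ∈ D, π x = σ x := by
  simp only [Extends, cyclesOn, pathsOn, List.forall_mem_map, Finset.mem_toList, follows_iterate,
    follows_iterate_cycle (minimalPeriod_pos _) (Function.isPeriodicPt_minimalPeriod σ _)]
  constructor
  · rintro ⟨h1, h2⟩ x hx
    by_cases hc : x ∈ core σ D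
    · obtain ⟨r, hr, t, ht, rfl⟩ := exists_coreRep hc
      exact h1 r hr t ht
    · obtain ⟨s, hs, t, ht, rfl⟩ := exists_start hx hc
      exact h2 s hs t ht
  · exact fun h => ⟨fun r hr t _ => h _ (mem_core.1 (mem_coreReps.1 hr).1 t),
      fun s hs t ht => h _ (iterate_mem_of_lt_exitTime (notMem_core_of_mem_starts hs) ht)⟩

lemma mem_flatten_cyclesOn {x : Fin n} : x ∈ (cyclesOn σ D).flatten ↔ x ∈ core σ D := by
  simp only [flatten_cyclesOn, List.mem_flatMap, Finset.mem_toList, List.mem_iterate]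
  constructor
  · rintro ⟨r, hr, t, -, rfl⟩
    exact iterate_mem_core (mem_coreReps.1 hr).1 t
  · intro hx
    obtain ⟨r, hr, t, ht, rfl⟩ := exists_coreRep hx
    exact ⟨r, hr, t, ht, rfl⟩

lemma toFinset_flatten :
    ((cyclesOn σ D).flatten ++ (pathsOn σ D).flatten).toFinset = D ∪ D.image σ := by
  ext x
  simp only [List.mem_toFinset, List.mem_append, mem_flatten_cyclesOn, flatten_pathsOn,
    List.mem_flatMap, Finset.mem_toList, List.mem_iterate, Finset.mem_union, Finset.mem_image]
  have hD : ∀ x ∈ D, x ∈ core σ D ∨ ∃ s ∈ starts σ D, ∃ t < exitTime σ D s, σ^[t] s = x :=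
    fun x hx => (em _).imp_right (exists_start hx)
  constructor
  · rintro (hx | ⟨s, hs, t, ht, rfl⟩)
    · exact Or.inl (mem_core.1 hx 0)
    · rcases t with _ | t
      · exact Or.inl (mem_starts.1 hs).1
      · exact Or.inr ⟨_, iterate_mem_of_lt_exitTime (notMem_core_of_mem_starts hs)
          (Nat.lt_of_succ_lt_succ ht), (Function.iterate_succ_apply' ..).symm⟩
  · rintro (hx | ⟨x, hx, rfl⟩)
    · rcases hD x hx with h | ⟨s, hs, t, ht, rfl⟩
      · exact Or.inl h
      · exact Or.inr ⟨s, hs, t, by omega, rfl⟩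
    · rcases hD x hx with h | ⟨s, hs, t, ht, rfl⟩
      · exact Or.inl (iterate_mem_core h 1)
      · exact Or.inr ⟨s, hs, t + 1, by omega, (Function.iterate_succ_apply' ..).symm⟩

lemma map_length_cyclesOn : (cyclesOn σ D).map List.length =
    (coreReps σ D).toList.map (Function.minimalPeriod σ) := by
  simp [cyclesOn, Function.comp_def]

lemma map_length_pathsOn : (pathsOn σ D).map List.length =
    (starts σ D).toList.map fun s => exitTime σ D s + 1 := by
  simp [pathsOn, Function.comp_def]

/-- The restriction of `σ` to `D` has as many edges as `D` has elements. -/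
lemma sum_minimalPeriod_add_sum_exitTime :
    ∑ r ∈ coreReps σ D, Function.minimalPeriod σ r + ∑ s ∈ starts σ D, exitTime σ D s = D.card := by
  have h1 := List.toFinset_card_of_nodup (nodup_cyclesOn_append_pathsOn (σ := σ) (D := D))
  have h2 : (D ∪ D.image σ) = D.image σ ∪ starts σ D := by
    ext x
    simp only [Finset.mem_union, Finset.mem_image, mem_starts]
    have : (∃ a ∈ D, σ a = x) ↔ σ.symm x ∈ D :=
      ⟨fun ⟨a, ha, h⟩ => by simpa [← h], fun h => ⟨_, h, by simp⟩⟩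
    rw [this]
    tauto
  have h3 : Disjoint (D.image σ) (starts σ D) := by
    rw [Finset.disjoint_left]
    intro x hx hx'
    obtain ⟨a, ha, rfl⟩ := Finset.mem_image.1 hx
    exact (mem_starts.1 hx').2 (by simpa)
  rw [toFinset_flatten, h2, Finset.card_union_of_disjoint h3,
    Finset.card_image_of_injective _ σ.injective, List.length_append, List.length_flatten,
    List.length_flatten, map_length_cyclesOn, map_length_pathsOn, Finset.sum_map_toList,
    Finset.sum_map_toList, Finset.sum_add_distrib, Finset.sum_const, smul_eq_mul, mul_one] at h1
  change (coreReps σ D).sum (Function.minimalPeriod σ) + _ = _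
  omega

end Configuration

section PartialPermutation

variable {n k : ℕ} {I J : Fin k → Fin n} {σ : Equiv.Perm (Fin n)}

lemma sum_replicate_card_filter {α : Type*} (s : Finset α) (f : α → ℕ) {N : ℕ}
    (h : ∀ x ∈ s, f x ≤ N) :
    ∑ i ∈ Finset.range (N + 1), Multiset.replicate (s.filter fun x => f x = i).card i =
      s.val.map f := by
  ext a
  rw [Multiset.count_sum', Multiset.count_map]
  simp only [Multiset.count_replicate, Finset.sum_ite_eq', Finset.mem_range]
  have h1 : (s.filter fun x => f x = a).card = (s.val.filter fun x => a = f x).card := by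
    simp only [Finset.card_def, Finset.filter_val, eq_comm]
  rw [← h1, ite_eq_left_iff]
  intro ha
  rw [eq_comm, Finset.card_eq_zero, Finset.filter_eq_empty_iff]
  intro x hx hxa
  have := h x hx
  omega

lemma pstep_val (hσ : ∀ ℓ, σ (I ℓ) = J ℓ) (x : Fin n) :
    pstep (fun ℓ => (I ℓ : ℕ)) (fun ℓ => (J ℓ : ℕ)) x =
      if x ∈ Finset.univ.image I then some (σ x : ℕ) else none := by
  unfold pstep
  by_cases h : ∃ ℓ, (I ℓ : ℕ) = x
  · have hx : I h.choose = x := Fin.ext h.choose_spec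
    rw [dif_pos h, if_pos (Finset.mem_image.2 ⟨_, Finset.mem_univ _, hx⟩)]
    exact congrArg (fun y : Fin n => some (y : ℕ)) ((hσ _).symm.trans (congrArg σ hx))
  · rw [dif_neg h, if_neg]
    simpa [Fin.ext_iff] using h

lemma piter_val (hσ : ∀ ℓ, σ (I ℓ) = J ℓ) (x : Fin n) (t : ℕ) :
    piter (fun ℓ => (I ℓ : ℕ)) (fun ℓ => (J ℓ : ℕ)) t x =
      if ∀ s < t, σ^[s] x ∈ Finset.univ.image I then some (σ^[t] x : ℕ) else none := by
  induction t with
  | zero => simp [piter]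
  | succ t ih =>
    rw [piter, ih, Function.iterate_succ_apply']
    simp only [Nat.forall_lt_succ_right]
    split_ifs with h1 h2 h2
    · rw [Option.bind_some, pstep_val hσ, if_pos h2.2]
    · rw [Option.bind_some, pstep_val hσ, if_neg fun h => h2 ⟨h1, h⟩]
    · exact absurd h2.1 h1
    · rfl

lemma pverts_val : pverts (fun ℓ => (I ℓ : ℕ)) (fun ℓ => (J ℓ : ℕ)) =
    (Finset.univ.image I ∪ Finset.univ.image J).map Fin.valEmbedding := by
  ext x
  simp [pverts, or_and_right, exists_or]

lemma card_filter_pverts (P : ℕ → Prop) [DecidablePred P] :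
    ((pverts (fun ℓ => (I ℓ : ℕ)) (fun ℓ => (J ℓ : ℕ))).filter P).card =
      ((Finset.univ.image I ∪ Finset.univ.image J).filter fun x : Fin n => P x).card := by
  rw [pverts_val, Finset.filter_map, Finset.card_map]
  rfl

lemma image_eq_image_perm (hσ : ∀ ℓ, σ (I ℓ) = J ℓ) :
    Finset.univ.image J = (Finset.univ.image I).image σ := by
  rw [Finset.image_image]
  exact Finset.image_congr fun ℓ _ => (hσ ℓ).symm

lemma pathMult_eq (hσ : ∀ ℓ, σ (I ℓ) = J ℓ) (ℓ : ℕ) :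
    pathMult (fun ℓ => (I ℓ : ℕ)) (fun ℓ => (J ℓ : ℕ)) ℓ =
      ((starts σ (Finset.univ.image I)).filter
        fun x => exitTime σ (Finset.univ.image I) x = ℓ).card := by
  rw [pathMult, card_filter_pverts]
  congr 1
  ext x
  have hJ : (∀ a, (J a : ℕ) ≠ x) ↔ σ.symm x ∉ Finset.univ.image I := by
    simp only [← hσ, Finset.mem_image, Finset.mem_univ, true_and, not_exists, ne_eq, Fin.val_inj,
      Equiv.eq_symm_apply]
  have hJ' : x ∈ Finset.univ.image J ↔ σ.symm x ∈ Finset.univ.image I := by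
    simp [← hσ, Equiv.eq_symm_apply]
  rw [Finset.mem_filter, Finset.mem_filter, Finset.mem_union, mem_starts, hJ, hJ', piter_val hσ,
    piter_val hσ]
  by_cases hs : x ∈ starts σ (Finset.univ.image I)
  · have hc := notMem_core_of_mem_starts hs
    have hs' := mem_starts.1 hs
    simp only [← le_exitTime_iff hc, hs'.1, hs'.2, not_false_eq_true, true_or, true_and, Option.isSome_ite,
      ite_eq_right_iff, reduceCtorEq, imp_false]
    omega
  · rw [mem_starts] at hs
    tauto

lemma mem_core_and_minimalPeriod_eq_iff {D : Finset (Fin n)} {x : Fin n} {i : ℕ} (hi : 0 < i) :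
    x ∈ core σ D ∧ Function.minimalPeriod σ x = i ↔
      (∀ s < i, σ^[s] x ∈ D) ∧ σ^[i] x = x ∧ ∀ t, 0 < t → t < i → σ^[t] x ≠ x := by
  constructor
  · rintro ⟨h1, rfl⟩
    exact ⟨fun s _ => mem_core.1 h1 s, Function.isPeriodicPt_minimalPeriod σ x,
      fun t h0 ht => Function.not_isPeriodicPt_of_pos_of_lt_minimalPeriod h0.ne' ht⟩
  · rintro ⟨h1, h2, h3⟩
    refine ⟨mem_core.2 fun t => ?_, ?_⟩
    · rw [← Function.IsPeriodicPt.iterate_mod_apply (n := i) h2 t]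
      exact h1 _ (Nat.mod_lt _ hi)
    · refine (Function.IsPeriodicPt.minimalPeriod_le hi h2).antisymm ?_
      by_contra! hlt
      exact h3 _ (minimalPeriod_pos x) hlt (Function.isPeriodicPt_minimalPeriod σ x)

lemma card_filter_core (D : Finset (Fin n)) (i : ℕ) :
    ((core σ D).filter fun x => Function.minimalPeriod σ x = i).card =
      ((coreReps σ D).filter fun x => Function.minimalPeriod σ x = i).card * i := by
  have h : ((core σ D).filter fun x => Function.minimalPeriod σ x = i) =
      ((coreReps σ D).filter fun x => Function.minimalPeriod σ x = i).biUnion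
        fun r => (Finset.range i).image fun t => σ^[t] r := by
    ext x
    simp only [Finset.mem_filter, Finset.mem_biUnion, Finset.mem_image, Finset.mem_range]
    constructor
    · rintro ⟨hx, rfl⟩
      obtain ⟨r, hr, t, ht, rfl⟩ := exists_coreRep hx
      have hp := Function.minimalPeriod_apply_iterate (σ.injective.mem_periodicPts r) t
      exact ⟨r, ⟨hr, hp.symm⟩, t, hp.symm ▸ ht, rfl⟩
    · rintro ⟨r, ⟨hr, rfl⟩, t, -, rfl⟩
      exact ⟨iterate_mem_core (mem_coreReps.1 hr).1 t,
        Function.minimalPeriod_apply_iterate (σ.injective.mem_periodicPts r) t⟩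
  rw [h, Finset.card_biUnion, Finset.sum_const_nat]
  · intro r hr
    rw [Finset.card_image_of_injOn, Finset.card_range]
    intro a ha b hb hab
    rw [Finset.coe_range, ← (Finset.mem_filter.1 hr).2] at ha hb
    exact Function.iterate_injOn_Iio_minimalPeriod ha hb hab
  · intro r hr r' hr' hne
    rw [Function.onFun, Finset.disjoint_left]
    intro x hx hx'
    obtain ⟨a, -, rfl⟩ := Finset.mem_image.1 hx
    obtain ⟨b, -, h⟩ := Finset.mem_image.1 hx'
    exact hne (coreReps_eq_of_iterate (Finset.mem_filter.1 hr).1 (Finset.mem_filter.1 hr').1 h.symm)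

lemma cycleMult_eq (hσ : ∀ ℓ, σ (I ℓ) = J ℓ) (i : ℕ) :
    cycleMult (fun ℓ => (I ℓ : ℕ)) (fun ℓ => (J ℓ : ℕ)) i =
      ((coreReps σ (Finset.univ.image I)).filter
        fun x => Function.minimalPeriod σ x = i).card := by
  rcases i.eq_zero_or_pos with rfl | hi
  · simp [cycleMult, (minimalPeriod_pos _).ne']
  rw [cycleMult, card_filter_pverts]
  apply Nat.div_eq_of_eq_mul_left hi
  rw [← card_filter_core]
  congr 1
  ext x
  simp only [Finset.mem_filter, mem_core_and_minimalPeriod_eq_iff hi, piter_val hσ]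
  constructor
  · rintro ⟨-, h1, h2⟩
    have h3 : ∀ s < i, σ^[s] x ∈ Finset.univ.image I := by
      by_contra h
      simp only [if_neg h, reduceCtorEq] at h1
    rw [if_pos h3, Option.some_inj, Fin.val_inj] at h1
    refine ⟨h3, h1, fun t h0 ht heq => h2 t h0 ht ?_⟩
    rw [if_pos fun s hs => h3 s (hs.trans ht), heq]
  · rintro ⟨h1, h2, h3⟩
    refine ⟨Finset.mem_union_left _ (h1 0 hi), by rw [if_pos h1, h2], fun t h0 ht => ?_⟩
    rw [if_pos fun s hs => h1 s (hs.trans ht), ne_eq, Option.some_inj, Fin.val_inj]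
    exact h3 t h0 ht

lemma exists_perm_extension (hI : Function.Injective I) (hJ : Function.Injective J) :
    ∃ σ : Equiv.Perm (Fin n), ∀ ℓ, σ (I ℓ) = J ℓ := by
  let e : {x // x ∈ Set.range I} ≃ {x // x ∈ Set.range J} :=
    (Equiv.ofInjective I hI).symm.trans (Equiv.ofInjective J hJ)
  refine ⟨e.extendSubtype, fun ℓ => ?_⟩
  rw [e.extendSubtype_apply_of_mem _ (Set.mem_range_self ℓ)]
  simp [e]

lemma exists_perm_map_eq {α β : Type*} {f : α → β} {l l' : List β} (h : l.Perm l') :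
    ∀ {s : List α}, s.map f = l → ∃ s', s.Perm s' ∧ s'.map f = l' := by
  induction h with
  | nil => exact fun h => ⟨_, .refl _, h⟩
  | cons b _ ih =>
    intro s hs
    obtain ⟨a, s, rfl, rfl, h⟩ := List.map_eq_cons_iff.1 hs
    obtain ⟨s', hp, rfl⟩ := ih h
    exact ⟨a :: s', hp.cons a, rfl⟩
  | swap b c _ =>
    intro s hs
    obtain ⟨a, s, rfl, rfl, h⟩ := List.map_eq_cons_iff.1 hs
    obtain ⟨a', s, rfl, rfl, rfl⟩ := List.map_eq_cons_iff.1 h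
    exact ⟨a' :: a :: s, .swap .., rfl⟩
  | trans _ _ ih₁ ih₂ =>
    intro s hs
    obtain ⟨s', hp, hs'⟩ := ih₁ hs
    obtain ⟨s'', hp', h⟩ := ih₂ hs'
    exact ⟨s'', hp.trans hp', h⟩

/-- The cycles and paths of `G(I,J)`, with lengths listed in the order given by the cycle-path type,
form a configuration whose extensions are the permutations extending `(I,J)`. -/
lemma exists_configuration (hI : Function.Injective I) (hJ : Function.Injective J)
    {μ ν : Multiset ℕ} (hμ : cyclePart (fun ℓ => (I ℓ : ℕ)) (fun ℓ => (J ℓ : ℕ)) = μ)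
    (hν : pathPart (fun ℓ => (I ℓ : ℕ)) (fun ℓ => (J ℓ : ℕ)) = ν) :
    μ.sum + ν.sum = k ∧ (∀ a ∈ μ, 0 < a) ∧ (∀ b ∈ ν, 0 < b) ∧
      ∃ cs ps : List (List (Fin n)), cs.map List.length = μ.toList ∧
        ps.map List.length = ν.toList.map (· + 1) ∧ (cs.flatten ++ ps.flatten).Nodup ∧
        (cs.flatten ++ ps.flatten).toFinset = Finset.image I Finset.univ ∪ Finset.image J Finset.univ ∧
        ∀ π : Equiv.Perm (Fin n), Extends π cs ps ↔ ∀ ℓ, π (I ℓ) = J ℓ := by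
  obtain ⟨σ, hσ⟩ := exists_perm_extension hI hJ
  have hsum := sum_minimalPeriod_add_sum_exitTime (σ := σ) (D := Finset.univ.image I)
  rw [Finset.card_image_of_injective _ hI, Finset.card_univ, Fintype.card_fin] at hsum
  have hμ' : (coreReps σ (Finset.univ.image I)).val.map (Function.minimalPeriod σ) = μ := by
    rw [← hμ, cyclePart, ← sum_replicate_card_filter _ _ fun r hr =>
      (Finset.single_le_sum (fun _ _ => Nat.zero_le _) hr).trans ((Nat.le_add_right _ _).trans_eq hsum)]
    simp only [cycleMult_eq hσ]
  have hν' : (starts σ (Finset.univ.image I)).val.map (exitTime σ (Finset.univ.image I)) = ν := by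
    rw [← hν, pathPart, ← sum_replicate_card_filter _ _ fun s hs =>
      (Finset.single_le_sum (fun _ _ => Nat.zero_le _) hs).trans ((Nat.le_add_left _ _).trans_eq hsum)]
    simp only [pathMult_eq hσ]
  refine ⟨by rw [← hμ', ← hν']; exact hsum, ?_, ?_, ?_⟩
  · rw [← hμ']
    intro a ha
    obtain ⟨r, -, rfl⟩ := Multiset.mem_map.1 ha
    exact minimalPeriod_pos r
  · rw [← hν']
    intro b hb
    obtain ⟨s, hs, rfl⟩ := Multiset.mem_map.1 hb
    exact exitTime_pos hs
  have hcs : ((cyclesOn σ (Finset.univ.image I)).map List.length).Perm μ.toList := by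
    rw [← Multiset.coe_eq_coe, Multiset.coe_toList, map_length_cyclesOn, ← Multiset.map_coe,
      Finset.coe_toList, hμ']
  have hps : ((pathsOn σ (Finset.univ.image I)).map List.length).Perm (ν.toList.map (· + 1)) := by
    rw [← Multiset.coe_eq_coe, map_length_pathsOn, ← Multiset.map_coe, ← Multiset.map_coe,
      Multiset.coe_toList, Finset.coe_toList, ← hν', Multiset.map_map]
    rfl
  obtain ⟨cs, hcs, hcs'⟩ := exists_perm_map_eq hcs rfl
  obtain ⟨ps, hps, hps'⟩ := exists_perm_map_eq hps rfl
  have hperm := hcs.flatten.append hps.flatten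
  refine ⟨cs, ps, hcs', hps', hperm.nodup nodup_cyclesOn_append_pathsOn, ?_, fun π => ?_⟩
  · rw [← List.toFinset_eq_of_perm _ _ hperm, toFinset_flatten, image_eq_image_perm hσ]
  · have h := extends_cyclesOn_pathsOn (σ := σ) (D := Finset.univ.image I) (π := π)
    simp only [Extends, hcs.mem_iff, hps.mem_iff] at h
    rw [Extends, h]
    simp [hσ]

end PartialPermutation

lemma expect_indic {n k : ℕ} {I J : Fin k → Fin n} (lam : Nat.Partition n)
    {cs ps : List (List (Fin n))} (h : ∀ π : Equiv.Perm (Fin n), Extends π cs ps ↔ ∀ ℓ, π (I ℓ) = J ℓ) :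
    expect lam (indic I J) = (extCount lam cs ps : ℝ) / (KClass lam).card := by
  simp only [expect, indic, extCount, Finset.sum_boole, h]

/-- Theorem 1.1 / `t:moment`.  For a partial permutation `(I,J)` of size `k`
with cycle–path type `(μ,ν)` and `|I ∪ J| = m`, there is a polynomial
`F ∈ ℤ[n, m_1, …, m_k]` (variable `0` is `n`, variable `i ≥ 1` is `m_i`), depending only on
`(μ,ν)`, of weighted degree at most `k` (where `deg n = 1`, `deg m_i = i`), such that for every
`n > 0`, every partial permutation `(I,J)` in `S_n` of cycle–path type `(μ,ν)`, and every
partition `λ` of `n`, `(n)_m ⬝ E_λ[1_{IJ}] = F(n, m_1(λ), …, m_k(λ))`. -/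
theorem statement0 (k : ℕ) (μ ν : Multiset ℕ) :
    ∃ F : MvPolynomial ℕ ℤ,
      F.vars ⊆ Finset.range (k + 1) ∧
      F.weightedTotalDegree (fun i => max i 1) ≤ k ∧
      ∀ (n : ℕ), 0 < n → ∀ (I J : Fin k → Fin n),
        Function.Injective I → Function.Injective J →
        cyclePart (fun ℓ => (I ℓ : ℕ)) (fun ℓ => (J ℓ : ℕ)) = μ →
        pathPart (fun ℓ => (I ℓ : ℕ)) (fun ℓ => (J ℓ : ℕ)) = ν →
        ∀ lam : Nat.Partition n,
          (n.descFactorial (Finset.image I Finset.univ ∪ Finset.image J Finset.univ).card : ℝ) *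
              expect lam (indic I J) =
            ((MvPolynomial.eval
                (fun i => if i = 0 then (n : ℤ) else (Multiset.count i lam.parts : ℤ)) F : ℤ) : ℝ) := by
  by_cases htype : μ.sum + ν.sum = k ∧ (∀ a ∈ μ, 0 < a) ∧ ∀ b ∈ ν, 0 < b
  · obtain ⟨hsum, hμ, hν⟩ := htype
    obtain ⟨F, hdeg, hF⟩ := exists_computes _ μ.toList (ν.toList.map (· + 1)) rfl
      (by simpa using hμ) (by simp)
    have hweight : μ.toList.sum + pathWeight (ν.toList.map (· + 1)) = k := by
      have : ν.toList.map ((fun b => max (b - 1) 1) ∘ (· + 1)) = ν.toList := by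
        conv_rhs => rw [← List.map_id ν.toList]
        refine List.map_congr_left fun b hb => ?_
        have := hν b (Multiset.mem_toList.1 hb)
        simp only [Function.comp_apply, id]
        omega
      rw [pathWeight, List.map_map, this, Multiset.sum_toList, Multiset.sum_toList, hsum]
    rw [hweight] at hdeg
    refine ⟨F, hdeg.vars_subset, hdeg, fun n _ I J hI hJ hIμ hJν lam => ?_⟩
    obtain ⟨-, -, -, cs, ps, hcs, hps, hnd, hV, hext⟩ := exists_configuration hI hJ hIμ hJν
    have key := hF n lam cs ps hcs hps hnd
    have hcard : (Finset.image I Finset.univ ∪ Finset.image J Finset.univ).card =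
        μ.toList.sum + (ν.toList.map (· + 1)).sum := by
      rw [← hV, List.toFinset_card_of_nodup hnd, List.length_append, List.length_flatten,
        List.length_flatten, hcs, hps]
    have hpos : (0 : ℝ) < (KClass lam).card := Nat.cast_pos.2 (card_KClass_pos lam)
    rw [expect_indic lam hext, hcard, ← mul_div_assoc, div_eq_iff hpos.ne']
    have key' := congrArg (Int.cast : ℤ → ℝ) key
    simp only [Int.cast_mul, Int.cast_natCast] at key'
    exact key'
  · refine ⟨0, by simp, by
      rw [← map_zero MvPolynomial.C]
      exact degreeLE_C 0, fun n _ I J hI hJ hIμ hJν _ => ?_⟩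
    obtain ⟨h1, h2, h3, -⟩ := exists_configuration hI hJ hIμ hJν
    exact absurd ⟨h1, h2, h3⟩ htype

end PaperStmt
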